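/- arXiv:math/9912018 — 3 statements merged into one kernel-verified Lean document; each statement's English description precedes it below -/
import Mathlib

section
/- There exists C > 0 such that for every integer k ≥ 0 and every φ ∈ 𝒪¹(ℂ̄∖[0,1]) whose real part is bounded on ℂ∖[0,1]: sup_{z∈ℂ∖[0,1]} |Re (T^k φ)(z)| ≤ C·(1 + k)·((√5 − 1)/2)^k · sup_{z∈ℂ∖[0,1]} |Re φ(z)|. In particular, T restricts to a bounded operator on the space E of functions in 𝒪¹(ℂ̄∖[0,1]) with bounded real part, normed by ‖φ‖_E = sup_{ℂ∖[0,1]} |Re φ|, with spectral radius at most (√5 − 1)/2. -/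
open Complex Filter Set Topology
open scoped ENNReal NNReal

noncomputable section

/-- The complement in `ℂ` of the real segment `[a, b]`. -/
def cutPlane (a b : ℝ) : Set ℂ := (Complex.ofReal '' Set.Icc a b)ᶜ

/-- `𝒪¹(ℂ̄ ∖ [a,b])`: holomorphic on `ℂ ∖ [a,b]`, vanishing at infinity. -/
def O1 (a b : ℝ) : Set (ℂ → ℂ) :=
  {φ | DifferentiableOn ℂ φ (cutPlane a b) ∧
       Tendsto φ (Bornology.cobounded ℂ) (nhds 0)}

/-- `𝒪³(ℂ̄ ∖ [a,b])`: holomorphic on `ℂ ∖ [a,b]`, with `z²ψ(z) → 0` at infinity. -/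
def O3 (a b : ℝ) : Set (ℂ → ℂ) :=
  {ψ | DifferentiableOn ℂ ψ (cutPlane a b) ∧
       Tendsto (fun z => z ^ 2 * ψ z) (Bornology.cobounded ℂ) (nhds 0)}

/-- The `m`-th term (for the integer `m+1 ≥ 1`) of the series defining `T`. -/
def Tterm (φ : ℂ → ℂ) (m : ℕ) (z : ℂ) : ℂ :=
  -z * (φ (z⁻¹ - ((m : ℂ) + 1)) - φ (-((m : ℂ) + 1))) + deriv φ (-((m : ℂ) + 1))

/-- The operator `T`. -/
def Tbrj (φ : ℂ → ℂ) : ℂ → ℂ := fun z => ∑' m : ℕ, Tterm φ m z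

/-- The operator `T⁽³⁾`. -/
def T3brj (ψ : ℂ → ℂ) : ℂ → ℂ := fun z => -∑' m : ℕ, (z⁻¹) ^ 3 * ψ (z⁻¹ - ((m : ℂ) + 1))

/-- `g(m) = (0 1; 1 m)`. -/
def gmat (m : ℤ) : Matrix (Fin 2) (Fin 2) ℤ := !![0, 1; 1, m]

/-- The monoid `ℳ`. -/
def Mmon : Set (Matrix (Fin 2) (Fin 2) ℤ) :=
  {g | g = 1 ∨
    ((g 0 0 * g 1 1 - g 0 1 * g 1 0 = 1 ∨ g 0 0 * g 1 1 - g 0 1 * g 1 0 = -1) ∧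
      g 0 1 ≤ g 1 1 ∧ g 0 0 ≤ g 0 1 ∧ 0 ≤ g 0 0 ∧ g 1 0 ≤ g 1 1 ∧ g 0 0 ≤ g 1 0)}

/-- The operator `L_g` on `𝒪¹(ℂ̄ ∖ [0,1])`, for `g = (a b; c d) ∈ ℳ`. -/
def Lop (g : Matrix (Fin 2) (Fin 2) ℤ) (φ : ℂ → ℂ) : ℂ → ℂ := fun z =>
  if g = 1 then φ z
  else
    ((g 0 0 : ℂ) - (g 1 0 : ℂ) * z) *
        (φ (((g 1 1 : ℂ) * z - (g 0 1 : ℂ)) / ((g 0 0 : ℂ) - (g 1 0 : ℂ) * z)) -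
          φ (-(g 1 1 : ℂ) / (g 1 0 : ℂ))) -
      ((g 0 0 * g 1 1 - g 0 1 * g 1 0 : ℤ) : ℂ) * ((g 1 0 : ℂ))⁻¹ *
        deriv φ (-(g 1 1 : ℂ) / (g 1 0 : ℂ))

/-- `Σ_ℳ φ`, the sum of the family `(L_g φ)_{g ∈ ℳ}`. -/
def sumM (φ : ℂ → ℂ) : ℂ → ℂ := fun z => ∑' g : Mmon, Lop g.1 φ z

/-- The domain `D`. -/
def Dset : Set ℂ :=
  {z | ‖z‖ ≤ 1 ∧ 1 ≤ ‖z - Complex.I‖ ∧ 1 ≤ ‖z + Complex.I‖ ∧ 0 < z.re}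

/-- The domain `D₀`. -/
def D0set : Set ℂ := {z | ‖z + 1‖ ≤ 1 ∧ Real.sqrt 3 / 2 - 1 ≤ z.re}

/-- The domain `D₁`. -/
def D1set : Set ℂ :=
  {z | 1 ≤ ‖z‖ ∧ ‖z - (1 / Real.sqrt 3 : ℝ)‖ ≤ 1 / Real.sqrt 3}

/-- The domain `H₀`. -/
def H0set : Set ℂ := {z | ‖z - Complex.I‖ ≤ 1 ∧ 1 ≤ ‖z + 1‖ ∧ z.im ≤ 1 / 2}

/-- The domain `H₀′`. -/
def H0set' : Set ℂ := {z | (starRingEnd ℂ) z ∈ H0set}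

/-- The domain `Δ`. -/
def Δset : Set ℂ := {z | ‖z‖ ≤ 1 ∧ 1 ≤ ‖z + 1‖ ∧ |z.im| ≤ 1 / 2}

/-- The domain `D∞`. -/
def Dinf : Set ℂ :=
  {z | 1 / 2 < |z.im|} ∪ {z | z.re < Real.sqrt 3 / 2 - 1} ∪
    {z | Real.sqrt 3 / 2 < z.re ∧ 1 / Real.sqrt 3 < ‖z - (1 / Real.sqrt 3 : ℝ)‖}

end

/-! ### The cut plane -/

lemma mem_cutPlane_zero_one {z : ℂ} :
    z ∈ cutPlane 0 1 ↔ ∀ x : ℝ, 0 ≤ x → x ≤ 1 → z ≠ x := by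
  simp only [cutPlane, mem_compl_iff, mem_image, mem_Icc, not_exists, not_and, and_imp]
  exact ⟨fun h x h0 h1 e => h x h0 h1 e.symm, fun h x h0 h1 e => h x h0 h1 e.symm⟩

lemma isOpen_cutPlane (a b : ℝ) : IsOpen (cutPlane a b) :=
  ((isCompact_Icc.image Complex.continuous_ofReal).isClosed).isOpen_compl

lemma mem_cutPlane_of_re_neg {z : ℂ} (h : z.re < 0) : z ∈ cutPlane 0 1 := by
  rw [mem_cutPlane_zero_one]
  rintro x h0 - rfl
  simp at h
  linarith

lemma mem_cutPlane_of_im_ne_zero {z : ℂ} (h : z.im ≠ 0) : z ∈ cutPlane 0 1 := by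
  rw [mem_cutPlane_zero_one]
  rintro x - - rfl
  simp at h

lemma mem_cutPlane_of_half_lt_norm {z : ℂ} (h : 1 / 2 < ‖z - 1 / 2‖) : z ∈ cutPlane 0 1 := by
  rw [mem_cutPlane_zero_one]
  rintro x h0 h1 rfl
  have : ((x : ℂ) - 1 / 2) = ((x - 1 / 2 : ℝ) : ℂ) := by push_cast; ring
  rw [this, Complex.norm_real, Real.norm_eq_abs] at h
  exact absurd h (not_lt.2 (abs_le.2 ⟨by linarith, by linarith⟩))

lemma ne_zero_of_mem_cutPlane {z : ℂ} (h : z ∈ cutPlane 0 1) : z ≠ 0 := by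
  simpa using mem_cutPlane_zero_one.1 h 0 le_rfl zero_le_one

lemma ne_of_mem_cutPlane_of_div {z : ℂ} (hz : z ∈ cutPlane 0 1) {p q : ℝ} (hp : 0 ≤ p)
    (hpq : p ≤ q) (hq : 0 < q) : (p : ℂ) - q * z ≠ 0 := by
  intro e
  refine mem_cutPlane_zero_one.1 hz (p / q) (by positivity) ((div_le_one hq).2 hpq) ?_
  have : (q : ℂ) ≠ 0 := by exact_mod_cast hq.ne'
  push_cast
  rw [eq_div_iff this]
  linear_combination -e

lemma inv_sub_mem_cutPlane {z : ℂ} (hz : z ∈ cutPlane 0 1) (m : ℕ) :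
    z⁻¹ - ((m : ℂ) + 1) ∈ cutPlane 0 1 := by
  rw [mem_cutPlane_zero_one]
  intro x h0 h1 e
  have hpos : 0 < x + (m + 1) := by positivity
  refine mem_cutPlane_zero_one.1 hz (x + (m + 1))⁻¹ (by positivity)
    (inv_le_one_of_one_le₀ (by linarith [m.cast_nonneg (α := ℝ)])) ?_
  push_cast
  rw [← e]
  simp

/-! ### Complex-analytic estimates -/

/-- Second order Taylor estimate for a bounded holomorphic function on a disc. -/
lemma norm_sub_sub_mul_deriv_le {f : ℂ → ℂ} {c w : ℂ} {r K : ℝ} (hr : 0 < r)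
    (hf : DifferentiableOn ℂ f (Metric.ball c r)) (hK : ∀ z ∈ Metric.ball c r, ‖f z‖ ≤ K)
    (hw : w ∈ Metric.ball c r) :
    ‖f w - f c - (w - c) * deriv f c‖ ≤ 4 * K * (‖w - c‖ / r) ^ 2 := by
  have hc : c ∈ Metric.ball c r := Metric.mem_ball_self hr
  have hda : DifferentiableAt ℂ f c := hf.differentiableAt (Metric.ball_mem_nhds c hr)
  have hmaps : MapsTo f (Metric.ball c r) (Metric.closedBall (f c) (2 * K)) := by
    intro z hz
    rw [mem_closedBall_iff_norm]
    linarith [norm_sub_le (f z) (f c), hK z hz, hK c hc]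
  have hderiv : ‖deriv f c‖ ≤ 2 * K / r :=
    Complex.norm_deriv_le_div_of_mapsTo_ball hf hmaps hr
  set g : ℂ → ℂ := fun z => f z - (z - c) * deriv f c with hg
  have hgc : g c = f c := by simp [hg]
  have hgd : DifferentiableOn ℂ g (Metric.ball c r) := by
    apply hf.sub
    fun_prop
  have hgm : MapsTo g (Metric.ball c r) (Metric.closedBall (g c) (4 * K)) := by
    intro z hz
    rw [mem_closedBall_iff_norm, hgc]
    have h1 : ‖f z - f c‖ ≤ 2 * K := mem_closedBall_iff_norm.1 (hmaps hz)
    have h2 : ‖(z - c) * deriv f c‖ ≤ 2 * K := by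
      rw [norm_mul]
      calc ‖z - c‖ * ‖deriv f c‖ ≤ r * (2 * K / r) := by
            gcongr
            exact (mem_ball_iff_norm.1 hz).le
        _ = 2 * K := by field_simp
    calc ‖g z - f c‖ = ‖(f z - f c) - (z - c) * deriv f c‖ := by simp only [hg]; ring_nf
      _ ≤ ‖f z - f c‖ + ‖(z - c) * deriv f c‖ := norm_sub_le _ _
      _ ≤ 4 * K := by linarith
  have ho : (fun z => g z - g c) =o[𝓝 c] fun z => ‖z - c‖ ^ 1 := by
    have := hda.hasDerivAt.isLittleO
    simp_rw [pow_one]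
    rw [Asymptotics.isLittleO_norm_right]
    refine this.congr_left fun z => ?_
    simp only [hg, smul_eq_mul]
    ring
  have := Complex.dist_le_mul_div_pow_of_mapsTo_ball_of_isLittleO hgd hgm ho hw
  rw [dist_eq_norm, dist_eq_norm, hgc] at this
  have e : f w - f c - (w - c) * deriv f c = g w - f c := by simp only [hg]; ring
  rw [e]
  exact this

/-- Cauchy's estimate for the derivative at the centre of a disc. -/
lemma norm_deriv_le_two_mul_div {f : ℂ → ℂ} {c : ℂ} {r K : ℝ} (hr : 0 < r)
    (hf : DifferentiableOn ℂ f (Metric.ball c r)) (hK : ∀ z ∈ Metric.ball c r, ‖f z‖ ≤ K) :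
    ‖deriv f c‖ ≤ 2 * K / r := by
  refine Complex.norm_deriv_le_div_of_mapsTo_ball hf (fun z hz => ?_) hr
  rw [mem_closedBall_iff_norm]
  linarith [norm_sub_le (f z) (f c), hK z hz, hK c (Metric.mem_ball_self hr)]

/-- Borel–Carathéodory outside the disc with diameter `[0,1]`, for functions vanishing at
infinity. -/
lemma norm_le_of_re_le_of_half_lt {φ : ℂ → ℂ} (hφ : φ ∈ O1 0 1) {M : ℝ} (hM : 0 < M)
    (hb : ∀ z ∈ cutPlane 0 1, |(φ z).re| ≤ M) {w : ℂ} (hw : 1 / 2 < ‖w - 1 / 2‖) :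
    ‖φ w‖ ≤ 2 * M / (2 * ‖w - 1 / 2‖ - 1) := by
  obtain ⟨hd, ht⟩ := hφ
  set f : ℂ → ℂ := Function.update (fun ζ => φ (1 / 2 + (2 * ζ)⁻¹)) 0 0 with hf
  have hfne : ∀ ζ : ℂ, ζ ≠ 0 → f ζ = φ (1 / 2 + (2 * ζ)⁻¹) := fun ζ h => by
    simp [hf, Function.update_of_ne h]
  have hmem : ∀ ζ ∈ Metric.ball (0 : ℂ) 1, ζ ≠ 0 → 1 / 2 + (2 * ζ)⁻¹ ∈ cutPlane 0 1 := by
    intro ζ hζ h0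
    apply mem_cutPlane_of_half_lt_norm
    rw [mem_ball_zero_iff] at hζ
    have : 0 < ‖ζ‖ := norm_pos_iff.2 h0
    rw [add_sub_cancel_left, norm_inv, norm_mul]
    simp only [Complex.norm_ofNat]
    rw [one_div]
    exact inv_strictAnti₀ (by positivity) (by linarith)
  have hcont : ContinuousAt f 0 := by
    rw [hf, continuousAt_update_same]
    refine ht.comp ?_
    have h1 : Tendsto (fun ζ : ℂ => (2 * ζ)⁻¹) (𝓝[≠] 0) (Bornology.cobounded ℂ) := by
      refine tendsto_inv₀_nhdsNE_zero.comp ?_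
      refine tendsto_nhdsWithin_iff.2 ⟨?_, ?_⟩
      · refine Tendsto.mono_left ?_ nhdsWithin_le_nhds
        have : Continuous fun ζ : ℂ => 2 * ζ := by fun_prop
        simpa using this.tendsto 0
      · filter_upwards [self_mem_nhdsWithin] with ζ hζ
        simpa using hζ
    exact (tendsto_const_add_cobounded (1 / 2 : ℂ)).comp h1
  have hdf : DifferentiableOn ℂ f (Metric.ball 0 1) := by
    rw [← differentiableOn_compl_singleton_and_continuousAt_iff
      (Metric.ball_mem_nhds (0 : ℂ) one_pos)]
    refine ⟨?_, hcont⟩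
    have : DifferentiableOn ℂ (fun ζ : ℂ => φ (1 / 2 + (2 * ζ)⁻¹)) (Metric.ball 0 1 \ {0}) := by
      refine hd.comp ?_ fun ζ hζ => hmem ζ hζ.1 (by simpa using hζ.2)
      intro ζ hζ
      have h0 : ζ ≠ 0 := by simpa using hζ.2
      have h2 : 2 * ζ ≠ 0 := by simpa using h0
      have : DifferentiableAt ℂ (fun ζ : ℂ => 1 / 2 + (2 * ζ)⁻¹) ζ := by
        fun_prop (disch := assumption)
      exact this.differentiableWithinAt
    exact this.congr fun ζ hζ => hfne ζ (by simpa using hζ.2)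
  have hmaps : MapsTo f (Metric.ball 0 1) {z | z.re ≤ M} := by
    intro ζ hζ
    by_cases h0 : ζ = 0
    · simp [h0, hf, hM.le]
    · simp only [mem_ofPred_eq, hfne ζ h0]
      exact (le_abs_self _).trans (hb _ (hmem ζ hζ h0))
  set ρ := ‖w - 1 / 2‖ with hρ
  have hρ0 : 0 < ρ := by linarith
  have hw0 : w - 1 / 2 ≠ 0 := norm_pos_iff.1 (by linarith)
  set ζ : ℂ := (2 * (w - 1 / 2))⁻¹ with hζ
  have hζn : ‖ζ‖ = 1 / (2 * ρ) := by
    rw [hζ, norm_inv, norm_mul, Complex.norm_ofNat, ← hρ, inv_eq_one_div]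
  have hζ0 : ζ ≠ 0 := by
    simp only [hζ, ne_eq, inv_eq_zero, mul_eq_zero, OfNat.ofNat_ne_zero, false_or]
    exact hw0
  have hζ1 : ‖ζ‖ < 1 := by
    rw [hζn, div_lt_one (by positivity)]
    linarith
  have key := Complex.borelCaratheodory_zero hM hdf hmaps one_pos (mem_ball_zero_iff.2 hζ1)
    (by simp [hf])
  have hval : f ζ = φ w := by
    rw [hfne ζ hζ0, hζ]
    congr 1
    field_simp
    ring
  rw [hval, hζn] at key
  convert key using 1
  have : 2 * ρ - 1 ≠ 0 := by linarith
  field_simp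

lemma norm_le_of_two_le_norm {φ : ℂ → ℂ} (hφ : φ ∈ O1 0 1) {M : ℝ} (hM : 0 < M)
    (hb : ∀ z ∈ cutPlane 0 1, |(φ z).re| ≤ M) {w : ℂ} (hw : 2 ≤ ‖w‖) : ‖φ w‖ ≤ M := by
  have h1 : 3 / 2 ≤ ‖w - 1 / 2‖ := by
    have := norm_sub_norm_le w (1 / 2)
    norm_num at this ⊢
    linarith
  refine (norm_le_of_re_le_of_half_lt hφ hM hb (by linarith)).trans ?_
  rw [div_le_iff₀ (by linarith)]
  nlinarith

lemma norm_le_on_ball_neg {φ : ℂ → ℂ} (hφ : φ ∈ O1 0 1) {M : ℝ} (hM : 0 < M)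
    (hb : ∀ z ∈ cutPlane 0 1, |(φ z).re| ≤ M) {n : ℝ} (hn : 0 < n) {w : ℂ}
    (hw : w ∈ Metric.ball (-(n : ℂ)) (n / 2)) : ‖φ w‖ ≤ 2 * M / n := by
  rw [mem_ball_iff_norm] at hw
  have h1 : n / 2 + 1 / 2 ≤ ‖w - 1 / 2‖ := by
    have h2 : w - 1 / 2 = (w - -(n : ℂ)) - ((n + 1 / 2 : ℝ) : ℂ) := by push_cast; ring
    have h3 : ‖((n + 1 / 2 : ℝ) : ℂ)‖ = n + 1 / 2 := by
      rw [Complex.norm_real, Real.norm_eq_abs, abs_of_pos (by linarith)]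
    have := norm_sub_norm_le (((n + 1 / 2 : ℝ) : ℂ)) (w - -(n : ℂ))
    rw [h2, norm_sub_rev]
    linarith
  refine (norm_le_of_re_le_of_half_lt hφ hM hb (by linarith)).trans ?_
  gcongr
  linarith

lemma ball_neg_subset_cutPlane {n r : ℝ} (hr : r ≤ n) :
    Metric.ball (-(n : ℂ)) r ⊆ cutPlane 0 1 := by
  intro w hw
  rw [mem_ball_iff_norm] at hw
  apply mem_cutPlane_of_re_neg
  have := (Complex.abs_re_le_norm _).trans_lt hw
  simp at this
  linarith [(abs_lt.1 this).2]

lemma abs_im_mul_norm_le {φ : ℂ → ℂ} (hφ : φ ∈ O1 0 1) {M : ℝ} (hM : 0 < M)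
    (hb : ∀ z ∈ cutPlane 0 1, |(φ z).re| ≤ M) {w : ℂ} (hw : ‖w‖ < 2) :
    |w.im| * ‖φ w‖ ≤ 14 * M := by
  rcases eq_or_ne w.im 0 with h0 | h0
  · simp [h0, hM.le]
  set y := |w.im| with hy
  have hy0 : 0 < y := abs_pos.2 h0
  have hy2 : y < 2 := (Complex.abs_im_le_norm w).trans_lt hw
  obtain ⟨σ, hσ, hσw⟩ : ∃ σ : ℝ, |σ| = 1 ∧ w.im = σ * y := by
    rcases lt_or_gt_of_ne h0 with h | h
    · exact ⟨-1, by simp, by rw [hy, abs_of_neg h]; ring⟩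
    · exact ⟨1, by simp, by rw [hy, abs_of_pos h]; ring⟩
  have hσ2 : σ * σ = 1 := by rw [← abs_mul_abs_self, hσ, one_mul]
  set p : ℂ := w + ((σ * (3 - y) : ℝ) : ℂ) * I with hp
  have hpim : p.im = 3 * σ := by
    simp [hp, hσw]
    ring
  have hpw : ‖w - p‖ = 3 - y := by
    simp only [hp, sub_add_cancel_left, norm_neg, norm_mul, Complex.norm_I, mul_one,
      Complex.norm_real, Real.norm_eq_abs]
    rw [hσ, one_mul, abs_of_pos (by linarith)]
  have hsub : ∀ ζ ∈ Metric.ball (0 : ℂ) 3, p + ζ ∈ cutPlane 0 1 := by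
    intro ζ hζ
    rw [mem_ball_zero_iff] at hζ
    apply mem_cutPlane_of_im_ne_zero
    intro h
    rw [Complex.add_im, hpim] at h
    have h1 : |ζ.im| < 3 := (Complex.abs_im_le_norm ζ).trans_lt hζ
    have h2 : ζ.im = -(3 * σ) := by linarith
    rw [h2, abs_neg, abs_mul, hσ] at h1
    norm_num at h1
  have hφp : ‖φ p‖ ≤ M := by
    apply norm_le_of_two_le_norm hφ hM hb
    have := Complex.abs_im_le_norm p
    rw [hpim, abs_mul, hσ] at this
    norm_num at this
    linarith
  have hp0 : p ∈ cutPlane 0 1 := by simpa using hsub 0 (by simp)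
  have key := Complex.borelCaratheodory_zero (f := fun ζ => φ (p + ζ) - φ p) (M := 2 * M)
    (R := 3) (z := w - p) (by positivity)
    ((hφ.1.comp (by fun_prop) hsub).sub_const _)
    (fun ζ hζ => by
      simp only [mem_ofPred_eq, Complex.sub_re]
      linarith [(abs_le.1 (hb _ (hsub ζ hζ))).2, (abs_le.1 (hb _ hp0)).1])
    (by norm_num) (by rw [mem_ball_zero_iff, hpw]; linarith) (by simp)
  rw [hpw] at key
  simp only [add_sub_cancel] at key
  have e : (3 : ℝ) - (3 - y) = y := by ring
  rw [e, le_div_iff₀ hy0] at key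
  have h3 : ‖φ w‖ ≤ ‖φ w - φ p‖ + ‖φ p‖ := norm_le_norm_sub_add _ _
  nlinarith

/-- The real part of `φ(w)/t` is controlled by `M/|t|` when `Im w = Im t` and `t` is not small. -/
lemma abs_re_div_le {φ : ℂ → ℂ} (hφ : φ ∈ O1 0 1) {M : ℝ} (hM : 0 < M)
    (hb : ∀ z ∈ cutPlane 0 1, |(φ z).re| ≤ M) {w t : ℂ} (hwc : w ∈ cutPlane 0 1)
    (him : w.im = t.im) (ht : 1 / 4 < ‖t‖) : |(φ w / t).re| ≤ 57 * M / ‖t‖ := by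
  have hs : 0 < ‖t‖ := by linarith
  rcases le_or_gt 2 ‖w‖ with h | h
  · refine (Complex.abs_re_le_norm _).trans ?_
    rw [norm_div]
    gcongr
    linarith [norm_le_of_two_le_norm hφ hM hb h]
  · have h1 := abs_im_mul_norm_le hφ hM hb h
    have e : (φ w / t).re = ((φ w).re * t.re + (φ w).im * t.im) / ‖t‖ ^ 2 := by
      rw [Complex.div_re, Complex.normSq_eq_norm_sq]
      ring
    rw [e, abs_div, abs_of_pos (by positivity : 0 < ‖t‖ ^ 2), div_le_div_iff₀ (by positivity) hs]
    have h2 : |(φ w).re * t.re + (φ w).im * t.im| ≤ M * ‖t‖ + 14 * M := by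
      refine (abs_add_le _ _).trans (add_le_add ?_ ?_)
      · rw [abs_mul]
        exact mul_le_mul (hb w hwc) (Complex.abs_re_le_norm t) (abs_nonneg _) hM.le
      · rw [abs_mul, ← him, mul_comm]
        exact (mul_le_mul_of_nonneg_left (Complex.abs_im_le_norm _) (abs_nonneg _)).trans h1
    have h3 : M * ‖t‖ + 14 * M ≤ 57 * M * ‖t‖ := by nlinarith
    calc _ ≤ (57 * M * ‖t‖) * ‖t‖ := by gcongr; exact h2.trans h3
      _ = _ := by ring

/-- The normalised second order Taylor remainder of `φ` at `-n`. -/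
noncomputable def taylorRemainder (φ : ℂ → ℂ) (n : ℝ) (t : ℂ) : ℂ :=
  (φ (-(n : ℂ) + t) - φ (-(n : ℂ)) - t * deriv φ (-(n : ℂ))) / t

lemma norm_deriv_neg_le {φ : ℂ → ℂ} (hφ : φ ∈ O1 0 1) {M : ℝ} (hM : 0 < M)
    (hb : ∀ z ∈ cutPlane 0 1, |(φ z).re| ≤ M) {n : ℝ} (hn : 0 < n) :
    ‖deriv φ (-(n : ℂ))‖ ≤ 8 * M / n ^ 2 := by
  have := norm_deriv_le_two_mul_div (half_pos hn)
    (hφ.1.mono (ball_neg_subset_cutPlane (by linarith)))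
    (fun z hz => norm_le_on_ball_neg hφ hM hb hn hz)
  convert this using 1
  field_simp
  norm_num

lemma abs_re_taylorRemainder_le_of_le {φ : ℂ → ℂ} (hφ : φ ∈ O1 0 1) {M : ℝ} (hM : 0 < M)
    (hb : ∀ z ∈ cutPlane 0 1, |(φ z).re| ≤ M) {n : ℝ} (hn : 1 ≤ n) {t : ℂ} (ht : t ≠ 0)
    (hs : ‖t‖ ≤ n / 4) : |(taylorRemainder φ n t).re| ≤ 32 * M * (‖t‖ / n ^ 2) := by
  have hn0 : 0 < n := by linarith
  have hs0 : 0 < ‖t‖ := norm_pos_iff.2 ht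
  refine (Complex.abs_re_le_norm _).trans ?_
  rw [taylorRemainder, norm_div, div_le_iff₀ hs0]
  have := norm_sub_sub_mul_deriv_le (half_pos hn0)
    (hφ.1.mono (ball_neg_subset_cutPlane (by linarith)))
    (fun z hz => norm_le_on_ball_neg hφ hM hb hn0 hz) (w := -(n : ℂ) + t)
    (by rw [mem_ball_iff_norm, add_sub_cancel_left]; linarith)
  rw [add_sub_cancel_left] at this
  refine this.trans ?_
  calc 4 * (2 * M / n) * (‖t‖ / (n / 2)) ^ 2 = 32 * M * ‖t‖ ^ 2 / n ^ 2 * (1 / n) := by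
        field_simp
        norm_num
    _ ≤ 32 * M * ‖t‖ ^ 2 / n ^ 2 * 1 := by
        gcongr
        rw [div_le_one hn0]
        exact hn
    _ = _ := by ring

lemma abs_re_taylorRemainder_le_of_lt {φ : ℂ → ℂ} (hφ : φ ∈ O1 0 1) {M : ℝ} (hM : 0 < M)
    (hb : ∀ z ∈ cutPlane 0 1, |(φ z).re| ≤ M) {n : ℝ} (hn : 1 ≤ n) {t : ℂ}
    (hs : n / 4 < ‖t‖) (hmem : -(n : ℂ) + t ∈ cutPlane 0 1) :
    |(taylorRemainder φ n t).re| ≤ 59 * M / ‖t‖ + 8 * M / n ^ 2 := by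
  have hn0 : 0 < n := by linarith
  have hs0 : 0 < ‖t‖ := by linarith
  have ht : t ≠ 0 := norm_pos_iff.1 hs0
  have e : taylorRemainder φ n t =
      φ (-(n : ℂ) + t) / t - φ (-(n : ℂ)) / t - deriv φ (-(n : ℂ)) := by
    rw [taylorRemainder]
    field_simp
  have h1 : |(φ (-(n : ℂ) + t) / t).re| ≤ 57 * M / ‖t‖ :=
    abs_re_div_le hφ hM hb hmem (by simp) (by linarith)
  have h2 : |(φ (-(n : ℂ)) / t).re| ≤ 2 * M / ‖t‖ := by
    refine (Complex.abs_re_le_norm _).trans ?_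
    rw [norm_div]
    gcongr
    refine (norm_le_on_ball_neg hφ hM hb hn0 (Metric.mem_ball_self (by linarith))).trans ?_
    exact div_le_self (by positivity) hn
  have h3 : |(deriv φ (-(n : ℂ))).re| ≤ 8 * M / n ^ 2 :=
    (Complex.abs_re_le_norm _).trans (norm_deriv_neg_le hφ hM hb hn0)
  rw [e, Complex.sub_re, Complex.sub_re]
  have h4 : 59 * M / ‖t‖ = 57 * M / ‖t‖ + 2 * M / ‖t‖ := by ring
  rw [abs_le] at *
  constructor <;> linarith

/-- A bound for the Taylor remainder which telescopes in `m`. -/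
lemma abs_re_taylorRemainder_le {φ : ℂ → ℂ} (hφ : φ ∈ O1 0 1) {M : ℝ} (hM : 0 < M)
    (hb : ∀ z ∈ cutPlane 0 1, |(φ z).re| ≤ M) {m n : ℝ} (hm : 1 ≤ m) (hmn : m ≤ n)
    {t : ℂ} (ht : t ≠ 0) (hmem : -(n : ℂ) + t ∈ cutPlane 0 1) :
    |(taylorRemainder φ n t).re| ≤ 2700 * M * (‖t‖ / ((‖t‖ + m) * (‖t‖ + m + 1)) +
      ‖t‖ / (‖t‖ + 1) * (1 / (m * (m + 1)))) := by
  have hs0 : 0 < ‖t‖ := norm_pos_iff.2 ht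
  set s := ‖t‖ with hs
  have hn : 1 ≤ n := hm.trans hmn
  have hm0 : 0 < m := by linarith
  have hn0 : 0 < n := by linarith
  rcases le_or_gt s (n / 4) with h | h
  · have h1 := abs_re_taylorRemainder_le_of_le hφ hM hb hn ht h
    rw [← hs] at h1
    have h2 : s / n ^ 2 ≤ 3 * (s / ((s + m) * (s + m + 1))) := by
      rw [mul_div_assoc', div_le_div_iff₀ (by positivity) (by positivity)]
      have : (s + m) * (s + m + 1) ≤ (n / 4 + n) * (n / 4 + n + n) := by gcongr
      have : (s + m) * (s + m + 1) ≤ 3 * n ^ 2 := by nlinarith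
      nlinarith
    have h3 : 0 ≤ s / ((s + m) * (s + m + 1)) := by positivity
    have h4 : 0 ≤ s / (s + 1) * (1 / (m * (m + 1))) := by positivity
    calc _ ≤ 32 * M * (s / n ^ 2) := h1
      _ ≤ 32 * M * (3 * (s / ((s + m) * (s + m + 1)))) := by gcongr
      _ = M * (96 * (s / ((s + m) * (s + m + 1)))) := by ring
      _ ≤ M * (2700 * (s / ((s + m) * (s + m + 1)) + s / (s + 1) * (1 / (m * (m + 1))))) := by
          refine mul_le_mul_of_nonneg_left ?_ hM.le
          linarith
      _ = _ := by ring
  · have h1 := abs_re_taylorRemainder_le_of_lt hφ hM hb hn h hmem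
    rw [← hs] at h1
    have h2 : 1 / s ≤ 45 * (s / ((s + m) * (s + m + 1))) := by
      rw [mul_div_assoc', div_le_div_iff₀ (by positivity) (by positivity)]
      have : (s + m) * (s + m + 1) ≤ (s + 4 * s) * (s + 4 * s + 4 * s) := by
        gcongr <;> linarith
      nlinarith
    have h3 : 1 / n ^ 2 ≤ 2 * (1 / (m * (m + 1))) := by
      rw [mul_one_div, div_le_div_iff₀ (by positivity) (by positivity)]
      nlinarith
    have h4 : 1 / 5 ≤ s / (s + 1) := by
      rw [div_le_div_iff₀ (by positivity) (by positivity)]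
      linarith
    have h5 : 0 ≤ 1 / (m * (m + 1)) := by positivity
    have h6 : 1 / n ^ 2 ≤ 10 * (s / (s + 1) * (1 / (m * (m + 1)))) := by nlinarith
    have h7 : 0 ≤ s / (s + 1) * (1 / (m * (m + 1))) := by positivity
    calc _ ≤ 59 * M / s + 8 * M / n ^ 2 := h1
      _ = M * (59 * (1 / s) + 8 * (1 / n ^ 2)) := by ring
      _ ≤ M * (2700 * (s / ((s + m) * (s + m + 1)) + s / (s + 1) * (1 / (m * (m + 1))))) := by
          refine mul_le_mul_of_nonneg_left ?_ hM.le
          have : 0 ≤ s / ((s + m) * (s + m + 1)) := by positivity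
          linarith
      _ = _ := by ring

lemma sum_one_div_mul_succ_le {s : ℝ} (hs : 0 ≤ s) (N : ℕ) :
    ∑ i ∈ Finset.range N, 1 / ((s + ((i : ℝ) + 1)) * (s + ((i : ℝ) + 1) + 1)) ≤ 1 / (s + 1) := by
  have h : ∀ i : ℕ, 1 / ((s + ((i : ℝ) + 1)) * (s + ((i : ℝ) + 1) + 1)) =
      1 / (s + ((i : ℝ) + 1)) - 1 / (s + (((i + 1 : ℕ) : ℝ) + 1)) := fun i => by
    push_cast
    field_simp
    ring
  rw [Finset.sum_congr rfl fun i _ => h i,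
    Finset.sum_range_sub' (fun i : ℕ => 1 / (s + ((i : ℝ) + 1)))]
  have : 0 ≤ 1 / (s + ((N : ℝ) + 1)) := by positivity
  simp only [Nat.cast_zero, zero_add]
  linarith

/-! ### Convergence of the series defining `T` -/

lemma exists_bound_of_re_le {ψ : ℂ → ℂ} (hψ : ψ ∈ O1 0 1) :
    ∃ K : ℝ, 0 < K ∧ ∀ w : ℂ, w.re ≤ -(1 / 2) → ‖ψ w‖ ≤ K := by
  obtain ⟨hd, ht⟩ := hψ
  have h1 : ∀ᶠ w in Bornology.cobounded ℂ, ‖ψ w‖ < 1 := by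
    simpa using ht.eventually (Metric.ball_mem_nhds (0 : ℂ) one_pos)
  rw [(Metric.hasBasis_cobounded_compl_closedBall (0 : ℂ)).eventually_iff] at h1
  obtain ⟨R, -, hR⟩ := h1
  have hcpt : IsCompact (Metric.closedBall (0 : ℂ) R ∩ {w : ℂ | w.re ≤ -(1 / 2)}) :=
    (isCompact_closedBall _ _).inter_right (isClosed_le Complex.continuous_re continuous_const)
  have hcont : ContinuousOn ψ (Metric.closedBall (0 : ℂ) R ∩ {w : ℂ | w.re ≤ -(1 / 2)}) :=
    hd.continuousOn.mono fun w hw => mem_cutPlane_of_re_neg (by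
      have : w.re ≤ -(1 / 2) := hw.2
      linarith)
  obtain ⟨C, hC⟩ := hcpt.exists_bound_of_continuousOn hcont
  refine ⟨max C 1, by positivity, fun w hw => ?_⟩
  by_cases hwR : w ∈ Metric.closedBall (0 : ℂ) R
  · exact (hC w ⟨hwR, hw⟩).trans (le_max_left _ _)
  · exact (hR hwR).le.trans (le_max_right _ _)

lemma norm_Tterm_le {ψ : ℂ → ℂ} (hψ : ψ ∈ O1 0 1) {K : ℝ}
    (hK : ∀ w : ℂ, w.re ≤ -(1 / 2) → ‖ψ w‖ ≤ K) {z : ℂ} (hz : z ≠ 0) {m : ℕ}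
    (hm : ‖z⁻¹‖ < ((m : ℝ) + 1) / 2) :
    ‖Tterm ψ m z‖ ≤ 16 * K * ‖z⁻¹‖ * (1 / ((m : ℝ) + 1) ^ 2) := by
  set n : ℝ := (m : ℝ) + 1 with hn
  have hm0 : (0 : ℝ) ≤ m := by positivity
  have hn0 : 0 < n := by positivity
  have hnc : (n : ℂ) = (m : ℂ) + 1 := by simp [hn]
  have hball : ∀ w ∈ Metric.ball (-(n : ℂ)) (n / 2), ‖ψ w‖ ≤ K := by
    intro w hw
    rw [mem_ball_iff_norm] at hw
    apply hK
    have := (Complex.abs_re_le_norm _).trans_lt hw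
    simp only [Complex.sub_re, Complex.neg_re, Complex.ofReal_re] at this
    linarith [(abs_lt.1 this).2]
  have key := norm_sub_sub_mul_deriv_le (half_pos hn0)
    (hψ.1.mono (ball_neg_subset_cutPlane (by linarith))) hball (w := z⁻¹ - n)
    (by rw [mem_ball_iff_norm]; simpa using hm)
  have e1 : z⁻¹ - (n : ℂ) - -(n : ℂ) = z⁻¹ := by ring
  rw [e1] at key
  have e : Tterm ψ m z = -z * (ψ (z⁻¹ - n) - ψ (-(n : ℂ)) - z⁻¹ * deriv ψ (-(n : ℂ))) := by
    rw [Tterm, ← hnc]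
    field_simp
    ring
  have hz0 : 0 < ‖z‖ := norm_pos_iff.2 hz
  rw [e, norm_mul, norm_neg]
  calc _ ≤ ‖z‖ * (4 * K * (‖z⁻¹‖ / (n / 2)) ^ 2) := by gcongr
    _ = _ := by
      rw [norm_inv]
      field_simp
      ring

lemma summable_one_div_succ_sq : Summable fun m : ℕ => 1 / ((m : ℝ) + 1) ^ 2 := by
  have := (summable_nat_add_iff 1).2 (Real.summable_one_div_nat_pow.2 (one_lt_two))
  simpa using this

lemma differentiableOn_Tterm {ψ : ℂ → ℂ} (hψ : ψ ∈ O1 0 1) (m : ℕ) :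
    DifferentiableOn ℂ (Tterm ψ m) (cutPlane 0 1) := by
  have h1 : DifferentiableOn ℂ (fun z : ℂ => ψ (z⁻¹ - ((m : ℂ) + 1))) (cutPlane 0 1) := by
    refine hψ.1.comp (fun z hz => ?_) fun z hz => inv_sub_mem_cutPlane hz m
    have := ne_zero_of_mem_cutPlane hz
    have : DifferentiableAt ℂ (fun z : ℂ => z⁻¹ - ((m : ℂ) + 1)) z := by
      fun_prop (disch := assumption)
    exact this.differentiableWithinAt
  exact (differentiableOn_id.neg.mul (h1.sub_const _)).add_const _

lemma exists_nhds_summable_Tterm {ψ : ℂ → ℂ} (hψ : ψ ∈ O1 0 1) {w : ℂ}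
    (hw : w ∈ cutPlane 0 1) : ∃ U : Set ℂ, IsOpen U ∧ w ∈ U ∧ U ⊆ cutPlane 0 1 ∧
      ∃ u : ℕ → ℝ, Summable u ∧ ∀ (m : ℕ) (z : ℂ), z ∈ U → ‖Tterm ψ m z‖ ≤ u m := by
  obtain ⟨K, hK0, hK⟩ := exists_bound_of_re_le hψ
  obtain ⟨ρ, hρ, hsub⟩ :=
    Metric.nhds_basis_closedBall.mem_iff.1 ((isOpen_cutPlane 0 1).mem_nhds hw)
  have hcpt : IsCompact (Metric.closedBall w ρ) := isCompact_closedBall _ _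
  have hne : ∀ z ∈ Metric.closedBall w ρ, z ≠ 0 := fun z hz => ne_zero_of_mem_cutPlane (hsub hz)
  obtain ⟨B, hB⟩ := hcpt.exists_bound_of_continuousOn (f := fun z : ℂ => z⁻¹)
    (continuousOn_id.inv₀ hne)
  choose D hD using fun m : ℕ => hcpt.exists_bound_of_continuousOn
    ((differentiableOn_Tterm hψ m).continuousOn.mono hsub)
  have hw' : w ∈ Metric.closedBall w ρ := Metric.mem_closedBall_self hρ.le
  have hB0 : 0 ≤ B := (norm_nonneg _).trans (hB w hw')
  refine ⟨Metric.ball w ρ, Metric.isOpen_ball, Metric.mem_ball_self hρ,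
    Metric.ball_subset_closedBall.trans hsub,
    fun m => (if ((m : ℝ) + 1) / 2 ≤ B then D m else 0) + 16 * K * B * (1 / ((m : ℝ) + 1) ^ 2),
    ?_, ?_⟩
  · refine Summable.add (summable_of_hasFiniteSupport ?_) (summable_one_div_succ_sq.mul_left _)
    refine (Set.finite_Iic ⌈2 * B⌉₊).subset fun m hm => ?_
    have hmB : ((m : ℝ) + 1) / 2 ≤ B := by
      by_contra h
      simp [h] at hm
    have : (m : ℝ) ≤ (⌈2 * B⌉₊ : ℝ) := by linarith [Nat.le_ceil (2 * B)]
    exact_mod_cast this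
  · intro m z hz
    have hz' := Metric.ball_subset_closedBall hz
    have h0 : 0 ≤ 16 * K * B * (1 / ((m : ℝ) + 1) ^ 2) := by positivity
    beta_reduce
    split_ifs with h
    · linarith [hD m z hz']
    · rw [zero_add]
      refine (norm_Tterm_le hψ hK (hne z hz') ((hB z hz').trans_lt (not_le.1 h))).trans ?_
      gcongr
      exact hB z hz'

lemma hasSum_Tterm {ψ : ℂ → ℂ} (hψ : ψ ∈ O1 0 1) {z : ℂ} (hz : z ∈ cutPlane 0 1) :
    HasSum (fun m => Tterm ψ m z) (Tbrj ψ z) := by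
  obtain ⟨U, -, hzU, -, u, hu, hle⟩ := exists_nhds_summable_Tterm hψ hz
  exact (Summable.of_norm_bounded hu fun m => hle m z hzU).hasSum

lemma hasSum_deriv_Tterm {ψ : ℂ → ℂ} (hψ : ψ ∈ O1 0 1) {z : ℂ} (hz : z ∈ cutPlane 0 1) :
    HasSum (fun m => deriv (Tterm ψ m) z) (deriv (Tbrj ψ) z) := by
  obtain ⟨U, hU, hzU, hsub, u, hu, hle⟩ := exists_nhds_summable_Tterm hψ hz
  exact Complex.hasSum_deriv_of_summable_norm hu
    (fun m => (differentiableOn_Tterm hψ m).mono hsub) hU hle hzU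

/-- `T` preserves `𝒪¹(ℂ̄ ∖ [0,1])`. -/
lemma Tbrj_mem_O1 {ψ : ℂ → ℂ} (hψ : ψ ∈ O1 0 1) : Tbrj ψ ∈ O1 0 1 := by
  refine ⟨fun z hz => ?_, ?_⟩
  · obtain ⟨U, hU, hzU, hsub, u, hu, hle⟩ := exists_nhds_summable_Tterm hψ hz
    have := Complex.differentiableOn_tsum_of_summable_norm hu
      (fun m => (differentiableOn_Tterm hψ m).mono hsub) hU hle
    exact (this.differentiableAt (hU.mem_nhds hzU)).differentiableWithinAt
  · obtain ⟨K, hK0, hK⟩ := exists_bound_of_re_le hψ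
    set S := ∑' m : ℕ, 1 / ((m : ℝ) + 1) ^ 2 with hS
    have h1 : Tendsto (fun z : ℂ => 16 * K * ‖z⁻¹‖ * S) (Bornology.cobounded ℂ) (𝓝 0) := by
      have := ((tendsto_inv₀_cobounded (α := ℂ)).norm.const_mul (16 * K)).mul_const S
      simpa using this
    refine squeeze_zero_norm' ?_ h1
    have h2 : ∀ᶠ z in Bornology.cobounded ℂ, ‖(z : ℂ)⁻¹‖ < 1 / 2 := by
      have := (tendsto_inv₀_cobounded (α := ℂ)).eventually
        (Metric.ball_mem_nhds (0 : ℂ) one_half_pos)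
      simpa using this
    have h3 : ∀ᶠ z in Bornology.cobounded ℂ, (z : ℂ) ≠ 0 :=
      Bornology.isBounded_def.1 (Bornology.isBounded_singleton (x := (0 : ℂ)))
    filter_upwards [h2, h3] with z hz h0
    refine tsum_of_norm_bounded (summable_one_div_succ_sq.hasSum.mul_left _) fun m => ?_
    refine norm_Tterm_le hψ hK h0 (hz.trans_le ?_)
    have : (0 : ℝ) ≤ m := by positivity
    linarith

lemma iterate_Tbrj_mem_O1 {φ : ℂ → ℂ} (hφ : φ ∈ O1 0 1) (k : ℕ) : Tbrj^[k] φ ∈ O1 0 1 := by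
  induction k with
  | zero => exact hφ
  | succ k ih => rw [Function.iterate_succ_apply']; exact Tbrj_mem_O1 ih

/-! ### The cocycle of Möbius operators -/

/-- The operator `L_g` for `g = (a b; c d)` with `c ≠ 0` and real entries. -/
noncomputable def moebiusOp (a b c d : ℝ) (ψ : ℂ → ℂ) (z : ℂ) : ℂ :=
  ((a : ℂ) - c * z) * (ψ (((d : ℂ) * z - b) / ((a : ℂ) - c * z)) - ψ (-((d : ℂ) / c))) -
    ((a : ℂ) * d - b * c) / c * deriv ψ (-((d : ℂ) / c))

lemma moebiusOp_zero_one_one (ψ : ℂ → ℂ) (m : ℕ) {z : ℂ} (hz : z ≠ 0) :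
    moebiusOp 0 (1 + ((m : ℝ) + 1) * 0) 1 (0 + ((m : ℝ) + 1) * 1) ψ z = Tterm ψ m z := by
  have e : (((m : ℂ) + 1) * z - 1) / (-z) = z⁻¹ - ((m : ℂ) + 1) := by
    field_simp
    ring
  simp [moebiusOp, Tterm, e]

lemma moebius_mem_cutPlane {a b c d : ℝ} (ha : 0 ≤ a) (hac : a ≤ c) (hc : 0 < c) (hb : 0 ≤ b)
    (hbd : b ≤ d) (hd : 0 < d) {z : ℂ} (hz : z ∈ cutPlane 0 1) :
    ((d : ℂ) * z - b) / ((a : ℂ) - c * z) ∈ cutPlane 0 1 := by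
  rw [mem_cutPlane_zero_one]
  intro x h0 h1 e
  have hne := ne_of_mem_cutPlane_of_div hz ha hac hc
  have hpos : 0 < d + c * x := by positivity
  have hcx : a * x ≤ c * x := mul_le_mul_of_nonneg_right hac h0
  refine mem_cutPlane_zero_one.1 hz ((b + a * x) / (d + c * x)) (by positivity)
    ((div_le_one hpos).2 (by linarith)) ?_
  rw [div_eq_iff hne] at e
  have : ((d + c * x : ℝ) : ℂ) ≠ 0 := by exact_mod_cast hpos.ne'
  rw [Complex.ofReal_div, eq_div_iff this]
  push_cast
  linear_combination e

lemma neg_div_mem_cutPlane {c d : ℝ} (hc : 0 < c) (hd : 0 < d) :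
    -((d : ℂ) / c) ∈ cutPlane 0 1 := by
  apply mem_cutPlane_of_re_neg
  rw [← Complex.ofReal_div, ← Complex.ofReal_neg, Complex.ofReal_re]
  have := div_pos hd hc
  linarith

lemma deriv_Tterm {ψ : ℂ → ℂ} (hψ : ψ ∈ O1 0 1) (m : ℕ) {w : ℂ} (hw : w ∈ cutPlane 0 1) :
    deriv (Tterm ψ m) w = -(ψ (w⁻¹ - ((m : ℂ) + 1)) - ψ (-((m : ℂ) + 1))) +
      w⁻¹ * deriv ψ (w⁻¹ - ((m : ℂ) + 1)) := by
  have hw0 := ne_zero_of_mem_cutPlane hw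
  have h1 : HasDerivAt ψ (deriv ψ (w⁻¹ - ((m : ℂ) + 1))) (w⁻¹ - ((m : ℂ) + 1)) :=
    (hψ.1.differentiableAt
      ((isOpen_cutPlane 0 1).mem_nhds (inv_sub_mem_cutPlane hw m))).hasDerivAt
  have h2 : HasDerivAt (fun z : ℂ => z⁻¹ - ((m : ℂ) + 1)) (-(w ^ 2)⁻¹) w :=
    (hasDerivAt_inv hw0).sub_const _
  have h3 := (((hasDerivAt_id w).neg.mul ((h1.comp w h2).sub_const (ψ (-((m : ℂ) + 1))))).add_const
    (deriv ψ (-((m : ℂ) + 1))))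
  have h4 : HasDerivAt (Tterm ψ m) _ w := h3
  rw [h4.deriv]
  simp only [Pi.neg_apply, id_eq, Function.comp_apply]
  field_simp

/-- The cocycle relation `L_h ∘ L_{g(m)} = L_{h g(m)}`. -/
lemma moebiusOp_Tterm {ψ : ℂ → ℂ} (hψ : ψ ∈ O1 0 1) (m : ℕ) {a b c d : ℝ} (hc : 0 < c)
    (hd : 0 < d) {z : ℂ} (haz : (a : ℂ) - c * z ≠ 0) (hbz : (b : ℂ) - d * z ≠ 0) :
    moebiusOp a b c d (Tterm ψ m) z =
      moebiusOp b (a + ((m : ℝ) + 1) * b) d (c + ((m : ℝ) + 1) * d) ψ z := by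
  have hc0 : (c : ℂ) ≠ 0 := by exact_mod_cast hc.ne'
  have hd0 : (d : ℂ) ≠ 0 := by exact_mod_cast hd.ne'
  have hdz : (d : ℂ) * z - b ≠ 0 := by
    intro h
    apply hbz
    linear_combination -h
  have e1 : ((((d : ℂ) * z - b) / ((a : ℂ) - c * z))⁻¹ - ((m : ℂ) + 1)) =
      (((c + ((m : ℝ) + 1) * d : ℝ) : ℂ) * z - ((a + ((m : ℝ) + 1) * b : ℝ) : ℂ)) /
        ((b : ℂ) - d * z) := by
    have h : ((a : ℂ) - c * z) / ((d : ℂ) * z - b) * ((b : ℂ) - d * z) = -((a : ℂ) - c * z) := by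
      rw [div_mul_eq_mul_div, div_eq_iff hdz]
      ring
    rw [inv_div, eq_div_iff hbz, sub_mul, h]
    push_cast
    ring
  have e2 : (-((d : ℂ) / c))⁻¹ - ((m : ℂ) + 1) = -(((c + ((m : ℝ) + 1) * d : ℝ) : ℂ) / d) := by
    push_cast
    field_simp
    ring
  rw [moebiusOp, moebiusOp, deriv_Tterm hψ m (neg_div_mem_cutPlane hc hd), Tterm, Tterm, e1, e2]
  generalize ψ ((((c + ((m : ℝ) + 1) * d : ℝ) : ℂ) * z - ((a + ((m : ℝ) + 1) * b : ℝ) : ℂ)) /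
        ((b : ℂ) - d * z)) = P
  generalize ψ (-(((c + ((m : ℝ) + 1) * d : ℝ) : ℂ) / d)) = R
  generalize deriv ψ (-(((c + ((m : ℝ) + 1) * d : ℝ) : ℂ) / d)) = E
  generalize ψ (-((m : ℂ) + 1)) = Q
  generalize deriv ψ (-((m : ℂ) + 1)) = D
  push_cast
  field_simp
  ring

lemma hasSum_moebiusOp {ψ : ℂ → ℂ} (hψ : ψ ∈ O1 0 1) {a b c d : ℝ} (ha : 0 ≤ a) (hac : a ≤ c)
    (hc : 0 < c) (hb : 0 ≤ b) (hbd : b ≤ d) (hd : 0 < d) {z : ℂ} (hz : z ∈ cutPlane 0 1) :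
    HasSum (fun m : ℕ => moebiusOp b (a + ((m : ℝ) + 1) * b) d (c + ((m : ℝ) + 1) * d) ψ z)
      (moebiusOp a b c d (Tbrj ψ) z) := by
  simp_rw [← moebiusOp_Tterm hψ _ hc hd (ne_of_mem_cutPlane_of_div hz ha hac hc)
    (ne_of_mem_cutPlane_of_div hz hb hbd hd)]
  have hw := moebius_mem_cutPlane ha hac hc hb hbd hd hz
  have hw0 := neg_div_mem_cutPlane hc hd
  exact (((hasSum_Tterm hψ hw).sub (hasSum_Tterm hψ hw0)).mul_left _).sub
    ((hasSum_deriv_Tterm hψ hw0).mul_left _)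

lemma moebiusOp_eq_taylorRemainder (φ : ℂ → ℂ) {a b c d : ℝ} (hc : 0 < c)
    (hdet : a * d - b * c ≠ 0) {z : ℂ} (haz : (a : ℂ) - c * z ≠ 0) :
    moebiusOp a b c d φ z = ((a * d - b * c) / c : ℝ) *
      taylorRemainder φ (d / c) (((a * d - b * c : ℝ) : ℂ) / (c * ((a : ℂ) - c * z))) := by
  have hc0 : (c : ℂ) ≠ 0 := by exact_mod_cast hc.ne'
  have hdet0 : (a : ℂ) * d - b * c ≠ 0 := by exact_mod_cast hdet
  have e : ((d : ℂ) * z - b) / ((a : ℂ) - c * z) =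
      -((d / c : ℝ) : ℂ) + ((a * d - b * c : ℝ) : ℂ) / (c * ((a : ℂ) - c * z)) := by
    rw [div_eq_iff haz, add_mul, div_mul_eq_mul_div, mul_div_mul_right _ _ haz]
    push_cast
    field_simp
    ring
  rw [moebiusOp, taylorRemainder, e]
  push_cast
  generalize φ (-((d : ℂ) / c) + ((a : ℂ) * d - b * c) / (c * ((a : ℂ) - c * z))) = P
  generalize φ (-((d : ℂ) / c)) = Q
  generalize deriv φ (-((d : ℂ) / c)) = R
  generalize (a : ℂ) * d - b * c = δ at hdet0 ⊢
  generalize (a : ℂ) - c * z = u at haz ⊢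
  field_simp

/-- The conditions on a real matrix `(a b; c d)` under which `x ↦ (a x + b) / (c x + d)` maps
`[0,1]` into itself, satisfied by all elements of the monoid generated by the `g(m)`. -/
structure IsAdmissible (a b c d : ℝ) : Prop where
  a_nonneg : 0 ≤ a
  b_nonneg : 0 ≤ b
  c_nonneg : 0 ≤ c
  d_pos : 0 < d
  b_le_d : b ≤ d
  c_le_d : c ≤ d
  add_le_add : a + b ≤ c + d
  det : a * d - b * c = 1 ∨ a * d - b * c = -1

lemma IsAdmissible.mul_gmat {a b c d : ℝ} (h : IsAdmissible a b c d) (i : ℕ) :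
    IsAdmissible b (a + ((i : ℝ) + 1) * b) d (c + ((i : ℝ) + 1) * d) := by
  obtain ⟨ha, hb, hc, hd, hbd, hcd, hs, hdet⟩ := h
  have hi : (0 : ℝ) ≤ i := by positivity
  have h1 : (i : ℝ) * b ≤ i * d := mul_le_mul_of_nonneg_left hbd hi
  have h2 : 0 ≤ (i : ℝ) * d := by positivity
  refine ⟨hb, by positivity, hd.le, by positivity, ?_, ?_, ?_, ?_⟩
  · linarith
  · linarith
  · linarith
  · rcases hdet with h | h
    · right
      linear_combination -h
    · left
      linear_combination -h

lemma IsAdmissible.abs_det {a b c d : ℝ} (h : IsAdmissible a b c d) : |a * d - b * c| = 1 := by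
  rcases h.det with e | e <;> simp [e]

lemma sum_abs_re_moebiusOp_le {φ : ℂ → ℂ} (hφ : φ ∈ O1 0 1) {M : ℝ} (hM : 0 < M)
    (hb : ∀ z ∈ cutPlane 0 1, |(φ z).re| ≤ M) {a b c d : ℝ} (h : IsAdmissible a b c d)
    {z : ℂ} (hz : z ∈ cutPlane 0 1) (N : ℕ) :
    ∑ i ∈ Finset.range N,
      |(moebiusOp b (a + ((i : ℝ) + 1) * b) d (c + ((i : ℝ) + 1) * d) φ z).re| ≤
      5400 * M / (d * (1 + d * ‖(b : ℂ) - d * z‖)) := by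
  have hd := h.d_pos
  have hbz := ne_of_mem_cutPlane_of_div hz h.b_nonneg h.b_le_d hd
  have hbz0 : 0 < ‖(b : ℂ) - d * z‖ := norm_pos_iff.2 hbz
  set s : ℝ := 1 / (d * ‖(b : ℂ) - d * z‖) with hs
  have hs0 : 0 < s := by positivity
  have hterm : ∀ i : ℕ,
      |(moebiusOp b (a + ((i : ℝ) + 1) * b) d (c + ((i : ℝ) + 1) * d) φ z).re| ≤
      2700 * M / d * (s * (1 / ((s + ((i : ℝ) + 1)) * (s + ((i : ℝ) + 1) + 1))) +
        s / (s + 1) * (1 / ((0 + ((i : ℝ) + 1)) * (0 + ((i : ℝ) + 1) + 1)))) := by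
    intro i
    have h' := h.mul_gmat i
    have hdet := h'.abs_det
    have hdet0 : b * (c + ((i : ℝ) + 1) * d) - (a + ((i : ℝ) + 1) * b) * d ≠ 0 := by
      intro e
      simp [e] at hdet
    rw [moebiusOp_eq_taylorRemainder φ hd hdet0 hbz, Complex.re_ofReal_mul, abs_mul, abs_div,
      hdet, abs_of_pos hd]
    set t : ℂ := ((b * (c + ((i : ℝ) + 1) * d) - (a + ((i : ℝ) + 1) * b) * d : ℝ) : ℂ) /
      (d * ((b : ℂ) - d * z)) with ht
    have htn : ‖t‖ = s := by
      rw [ht, norm_div, Complex.norm_real, Real.norm_eq_abs, hdet, norm_mul, Complex.norm_real,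
        Real.norm_eq_abs, abs_of_pos hd]
    have hmem : -(((c + ((i : ℝ) + 1) * d) / d : ℝ) : ℂ) + t ∈ cutPlane 0 1 := by
      convert moebius_mem_cutPlane h'.a_nonneg h.b_le_d hd h'.b_nonneg h'.b_le_d h'.d_pos hz
        using 1
      have hd0 : (d : ℂ) ≠ 0 := by exact_mod_cast hd.ne'
      rw [ht]
      push_cast
      field_simp
      ring
    have hi : (0 : ℝ) ≤ i := by positivity
    have key := abs_re_taylorRemainder_le hφ hM hb (m := (i : ℝ) + 1)
      (n := (c + ((i : ℝ) + 1) * d) / d) (by linarith)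
      (by rw [le_div_iff₀ hd]; linarith [h.c_nonneg])
      (norm_pos_iff.1 (by rw [htn]; exact hs0)) hmem
    rw [htn] at key
    calc _ ≤ 1 / d * _ := mul_le_mul_of_nonneg_left key (by positivity)
      _ = _ := by
        rw [zero_add]
        ring
  refine (Finset.sum_le_sum fun i _ => hterm i).trans ?_
  rw [← Finset.mul_sum, Finset.sum_add_distrib, ← Finset.mul_sum, ← Finset.mul_sum]
  have h1 := sum_one_div_mul_succ_le hs0.le N
  have h2 := sum_one_div_mul_succ_le le_rfl N
  calc _ ≤ 2700 * M / d * (s * (1 / (s + 1)) + s / (s + 1) * (1 / (0 + 1))) := by gcongr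
    _ = 5400 * M / d * (s / (s + 1)) := by ring
    _ = _ := by
      rw [hs]
      field_simp

/-! ### A logarithmic gauge on the line -/

/-- An increasing function of `y` whose increments near `x` dominate the terms of the orbit sum. -/
noncomputable def logGauge (F x y : ℝ) : ℝ :=
  if x ≤ y then Real.log (1 + F * √(y - x)) else -Real.log (1 + F * √(x - y))

lemma le_log_sub_log {F p q v : ℝ} (hF : 0 < F) (hp : 0 ≤ p) (hpq : p ≤ q) (hqv : q ≤ v)
    (hv : 0 < v) : F * (q - p) / (2 * √v * (1 + F * √v)) ≤
      Real.log (1 + F * √q) - Real.log (1 + F * √p) := by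
  have hP := Real.sqrt_nonneg p
  have hPQ := Real.sqrt_le_sqrt hpq
  have hQV := Real.sqrt_le_sqrt hqv
  have hV : 0 < √v := Real.sqrt_pos.2 hv
  have ep : √p ^ 2 = p := Real.sq_sqrt hp
  have eq : √q ^ 2 = q := Real.sq_sqrt (hp.trans hpq)
  have hQ := hP.trans hPQ
  rw [← Real.log_div (by positivity) (by positivity)]
  refine le_trans ?_ (Real.one_sub_inv_le_log_of_pos (by positivity))
  have e : 1 - ((1 + F * √q) / (1 + F * √p))⁻¹ = F * (√q - √p) / (1 + F * √q) := by
    rw [inv_div]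
    field_simp
    ring
  have hfac : q - p = (√q - √p) * (√q + √p) := by linear_combination ep - eq
  rw [e, hfac]
  calc _ ≤ F * ((√q - √p) * (2 * √v)) / (2 * √v * (1 + F * √q)) := by
        have hPQ' : 0 ≤ √q - √p := by linarith
        have hsum : √q + √p ≤ 2 * √v := by linarith
        refine div_le_div₀ (by positivity) ?_ (by positivity) ?_
        · exact mul_le_mul_of_nonneg_left (mul_le_mul_of_nonneg_left hsum hPQ') hF.le
        · gcongr
    _ = _ := by field_simp

lemma le_logGauge_sub {F x y₁ y₂ v : ℝ} (hF : 0 < F) (hy : y₁ ≤ y₂) (h₁ : |y₁ - x| ≤ v)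
    (h₂ : |y₂ - x| ≤ v) (hv : 0 < v) :
    F * (y₂ - y₁) / (2 * √v * (1 + F * √v)) ≤ logGauge F x y₂ - logGauge F x y₁ := by
  rw [abs_le] at h₁ h₂
  unfold logGauge
  split_ifs with h h' h'
  · have := le_log_sub_log hF (p := y₁ - x) (q := y₂ - x) (v := v) (by linarith) (by linarith)
      (by linarith) hv
    convert this using 3
    ring
  · rw [not_le] at h'
    have e1 := le_log_sub_log hF (p := 0) (q := y₂ - x) (v := v) le_rfl (by linarith)
      (by linarith) hv
    have e2 := le_log_sub_log hF (p := 0) (q := x - y₁) (v := v) le_rfl (by linarith)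
      (by linarith) hv
    simp only [Real.sqrt_zero, mul_zero, add_zero, Real.log_one, sub_zero] at e1 e2
    have e3 : F * (y₂ - y₁) / (2 * √v * (1 + F * √v)) =
        F * (y₂ - x) / (2 * √v * (1 + F * √v)) + F * (x - y₁) / (2 * √v * (1 + F * √v)) := by
      ring
    linarith
  · exact absurd (h'.trans hy) h
  · rw [not_le] at h h'
    have := le_log_sub_log hF (p := x - y₂) (q := x - y₁) (v := v) (by linarith) (by linarith)
      (by linarith) hv
    have e : x - y₁ - (x - y₂) = y₂ - y₁ := by ring
    rw [e] at this
    linarith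

lemma monotone_logGauge {F : ℝ} (hF : 0 < F) (x : ℝ) : Monotone (logGauge F x) := by
  intro y₁ y₂ hy
  have hv : 0 < max |y₁ - x| |y₂ - x| + 1 := by positivity
  have := le_logGauge_sub hF hy (v := max |y₁ - x| |y₂ - x| + 1)
    (by linarith [le_max_left |y₁ - x| |y₂ - x|]) (by linarith [le_max_right |y₁ - x| |y₂ - x|]) hv
  have h2 : 0 ≤ F * (y₂ - y₁) / (2 * √(max |y₁ - x| |y₂ - x| + 1) *
      (1 + F * √(max |y₁ - x| |y₂ - x| + 1))) :=
    div_nonneg (mul_nonneg hF.le (by linarith)) (by positivity)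
  linarith

lemma logGauge_one_sub_zero_le {F x : ℝ} (hF : 0 < F) (h0 : 0 ≤ x) (h1 : x ≤ 1) :
    logGauge F x 1 - logGauge F x 0 ≤ 2 * Real.log (1 + F) := by
  have hlog : ∀ u : ℝ, u ≤ 1 → Real.log (1 + F * √u) ≤ Real.log (1 + F) := by
    intro u hu
    apply Real.log_le_log (by positivity)
    have : √u ≤ 1 := Real.sqrt_le_one.2 hu
    nlinarith
  have e1 : logGauge F x 1 ≤ Real.log (1 + F) := by
    rw [logGauge, if_pos h1]
    exact hlog _ (by linarith)
  have e0 : -Real.log (1 + F) ≤ logGauge F x 0 := by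
    unfold logGauge
    split_ifs with h
    · have : 0 ≤ Real.log (1 + F * √(0 - x)) :=
        Real.log_nonneg (by linarith [mul_nonneg hF.le (Real.sqrt_nonneg (0 - x))])
      have : 0 ≤ Real.log (1 + F) := Real.log_nonneg (by linarith)
      linarith
    · linarith [hlog (x - 0) (by linarith)]
  linarith

lemma IsAdmissible.le_abs_logGauge_sub {a b c d : ℝ} (h : IsAdmissible a b c d) {F : ℝ}
    (hF : 0 < F) (hFd : F ≤ d) (x : ℝ) :
    1 / (d * (1 + d ^ 2 * |x - b / d|)) ≤
      8 / F * |logGauge F x ((a + b) / (c + d)) - logGauge F x (b / d)| := by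
  have hd := h.d_pos
  have hc := h.c_nonneg
  have hcd := h.c_le_d
  set u := |x - b / d| with hu
  have hu0 : 0 ≤ u := abs_nonneg _
  set v := u + 1 / d ^ 2 with hv
  have hv0 : 0 < v := by positivity
  have hdiff : |(a + b) / (c + d) - b / d| = 1 / (d * (c + d)) := by
    have : (a + b) / (c + d) - b / d = (a * d - b * c) / (d * (c + d)) := by
      field_simp
      ring
    rw [this, abs_div, h.abs_det, abs_of_pos (by positivity)]
  have hlen : 1 / (2 * d ^ 2) ≤ |(a + b) / (c + d) - b / d| := by
    rw [hdiff]
    apply one_div_le_one_div_of_le (by positivity)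
    nlinarith
  have hlen' : |(a + b) / (c + d) - b / d| ≤ 1 / d ^ 2 := by
    rw [hdiff]
    apply one_div_le_one_div_of_le (by positivity)
    nlinarith
  have hq : |b / d - x| ≤ v := by
    rw [abs_sub_comm, ← hu]
    have : 0 ≤ 1 / d ^ 2 := by positivity
    linarith
  have hp : |(a + b) / (c + d) - x| ≤ v := by
    have := abs_sub_le ((a + b) / (c + d)) (b / d) x
    rw [abs_sub_comm (b / d) x, ← hu] at this
    linarith
  have hgauge : F * |(a + b) / (c + d) - b / d| / (2 * √v * (1 + F * √v)) ≤
      |logGauge F x ((a + b) / (c + d)) - logGauge F x (b / d)| := by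
    rcases le_total (b / d) ((a + b) / (c + d)) with hle | hle
    · rw [abs_of_nonneg (sub_nonneg.2 hle)]
      exact (le_logGauge_sub hF hle hq hp hv0).trans (le_abs_self _)
    · rw [abs_sub_comm, abs_of_nonneg (sub_nonneg.2 hle), abs_sub_comm]
      exact (le_logGauge_sub hF hle hp hq hv0).trans (le_abs_self _)
  set X := 1 + d ^ 2 * u with hX
  have hX1 : 1 ≤ X := by
    have : 0 ≤ d ^ 2 * u := by positivity
    linarith
  have hvX : v = X / d ^ 2 := by
    rw [hv, hX]
    field_simp
    ring
  have hsq : √v ≤ X / d := by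
    apply Real.sqrt_le_iff.2 ⟨by positivity, ?_⟩
    rw [hvX, div_pow]
    gcongr
    nlinarith
  have hden : √v * (1 + F * √v) ≤ 2 * X / d := by
    have e : √v * √v = v := Real.mul_self_sqrt hv0.le
    calc √v * (1 + F * √v) = √v + F * (√v * √v) := by ring
      _ ≤ X / d + d * (X / d ^ 2) := by
          rw [e, hvX]
          rw [hvX] at hsq
          gcongr
      _ = 2 * X / d := by
          field_simp
          ring
  have hsv : 0 < √v := Real.sqrt_pos.2 hv0
  calc 1 / (d * X) = 8 / F * (F * (1 / (2 * d ^ 2)) / (2 * (2 * X / d))) := by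
        field_simp
        norm_num
    _ ≤ 8 / F * (F * |(a + b) / (c + d) - b / d| / (2 * (√v * (1 + F * √v)))) := by gcongr
    _ = 8 / F * (F * |(a + b) / (c + d) - b / d| / (2 * √v * (1 + F * √v))) := by
        rw [mul_assoc 2 (√v)]
    _ ≤ _ := by gcongr

lemma exists_mem_unit_abs_sub_le (z : ℂ) :
    ∃ x : ℝ, 0 ≤ x ∧ x ≤ 1 ∧ ∀ p : ℝ, 0 ≤ p → p ≤ 1 → |x - p| ≤ ‖z - p‖ := by
  refine ⟨max 0 (min 1 z.re), le_max_left _ _, max_le zero_le_one (min_le_left _ _),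
    fun p h0 h1 => ?_⟩
  have h2 : |z.re - p| ≤ ‖z - p‖ := by
    have := Complex.abs_re_le_norm (z - p)
    simpa using this
  refine le_trans ?_ h2
  have h3 := abs_max_sub_max_le_abs (min 1 z.re) p 0
  have h4 := abs_min_sub_min_le_max 1 z.re 1 p
  rw [max_comm, max_eq_left h0] at h3
  simp only [min_eq_right h1, sub_self, abs_zero] at h4
  refine h3.trans (h4.trans ?_)
  exact max_le (abs_nonneg _) le_rfl

/-! ### The orbit sum -/

lemma abs_re_le_of_hasSum {f : ℕ → ℂ} {S : ℂ} {B : ℝ} (hf : HasSum f S)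
    (hB : ∀ N, ∑ i ∈ Finset.range N, |(f i).re| ≤ B) : |S.re| ≤ B := by
  refine le_of_tendsto (Complex.hasSum_re hf).tendsto_sum_nat.abs (Eventually.of_forall fun N => ?_)
  exact (Finset.abs_sum_le_sum_abs _ _).trans (hB N)

lemma IsAdmissible.sum_abs_sub_le {a b c d : ℝ} (h : IsAdmissible a b c d) {A : ℝ → ℝ}
    (hA : Monotone A) (N : ℕ) :
    ∑ i ∈ Finset.range N,
      |A ((b + (a + ((i : ℝ) + 1) * b)) / (d + (c + ((i : ℝ) + 1) * d))) -
        A ((a + ((i : ℝ) + 1) * b) / (c + ((i : ℝ) + 1) * d))| ≤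
      |A ((a + b) / (c + d)) - A (b / d)| := by
  have hd := h.d_pos
  have hc := h.c_nonneg
  set x : ℕ → ℝ := fun i => (a + ((i : ℝ) + 1) * b) / (c + ((i : ℝ) + 1) * d) with hx
  have hpos : ∀ i : ℕ, 0 < c + ((i : ℝ) + 1) * d := fun i => by positivity
  have hsucc : ∀ i : ℕ,
      (b + (a + ((i : ℝ) + 1) * b)) / (d + (c + ((i : ℝ) + 1) * d)) = x (i + 1) := by
    intro i
    simp only [hx]
    push_cast
    congr 1 <;> ring
  have h0 : (a + b) / (c + d) = x 0 := by simp [hx]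
  have hstep : ∀ i : ℕ, (a * d - b * c) * (x i - x (i + 1)) =
      (a * d - b * c) ^ 2 / ((c + ((i : ℝ) + 1) * d) * (c + (((i + 1 : ℕ) : ℝ) + 1) * d)) := by
    intro i
    have := hpos i
    have := hpos (i + 1)
    simp only [hx]
    rw [div_sub_div _ _ (hpos i).ne' (hpos (i + 1)).ne', mul_div_assoc']
    congr 1
    push_cast
    ring
  have hlast : ∀ i : ℕ, (a * d - b * c) * (x i - b / d) =
      (a * d - b * c) ^ 2 / ((c + ((i : ℝ) + 1) * d) * d) := by
    intro i
    simp only [hx]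
    rw [div_sub_div _ _ (hpos i).ne' hd.ne', mul_div_assoc']
    congr 1
    ring
  have hstep0 : ∀ i : ℕ, 0 ≤ (a * d - b * c) * (x i - x (i + 1)) := fun i => by
    rw [hstep]
    have := hpos i
    have := hpos (i + 1)
    positivity
  have hlast0 : ∀ i : ℕ, 0 ≤ (a * d - b * c) * (x i - b / d) := fun i => by
    rw [hlast]
    have := hpos i
    positivity
  rw [h0]
  simp_rw [hsucc]
  change ∑ i ∈ Finset.range N, |A (x (i + 1)) - A (x i)| ≤ _
  rcases h.det with hdet | hdet
  · rw [hdet] at hstep0 hlast0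
    have hanti : ∀ i, A (x (i + 1)) ≤ A (x i) := fun i => hA (by linarith [hstep0 i])
    have hge : A (b / d) ≤ A (x N) := hA (by linarith [hlast0 N])
    calc ∑ i ∈ Finset.range N, |A (x (i + 1)) - A (x i)| =
        ∑ i ∈ Finset.range N, (A (x i) - A (x (i + 1))) := Finset.sum_congr rfl fun i _ => by
          rw [abs_sub_comm, abs_of_nonneg (sub_nonneg.2 (hanti i))]
      _ = A (x 0) - A (x N) := Finset.sum_range_sub' (fun i => A (x i)) N
      _ ≤ A (x 0) - A (b / d) := by linarith
      _ ≤ _ := le_abs_self _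
  · rw [hdet] at hstep0 hlast0
    have hmono : ∀ i, A (x i) ≤ A (x (i + 1)) := fun i => hA (by linarith [hstep0 i])
    have hle : A (x N) ≤ A (b / d) := hA (by linarith [hlast0 N])
    calc ∑ i ∈ Finset.range N, |A (x (i + 1)) - A (x i)| =
        ∑ i ∈ Finset.range N, (A (x (i + 1)) - A (x i)) := Finset.sum_congr rfl fun i _ => by
          rw [abs_of_nonneg (sub_nonneg.2 (hmono i))]
      _ = A (x N) - A (x 0) := Finset.sum_range_sub (fun i => A (x i)) N
      _ ≤ A (b / d) - A (x 0) := by linarith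
      _ ≤ _ := by
          rw [abs_sub_comm]
          exact le_abs_self _

lemma sum_abs_re_moebiusOp_iterate_le {φ : ℂ → ℂ} (hφ : φ ∈ O1 0 1) {M : ℝ} (hM : 0 < M)
    (hb : ∀ z ∈ cutPlane 0 1, |(φ z).re| ≤ M) {z : ℂ} (hz : z ∈ cutPlane 0 1) {F : ℝ}
    (hF : 0 < F) {x : ℝ} (hx : ∀ p : ℝ, 0 ≤ p → p ≤ 1 → |x - p| ≤ ‖z - p‖) (k : ℕ) :
    ∀ a b c d : ℝ, IsAdmissible a b c d → F ≤ Real.goldenRatio ^ k * d →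
      Real.goldenRatio * F ≤ Real.goldenRatio ^ k * (c + d) → ∀ N : ℕ,
      ∑ i ∈ Finset.range N, |(moebiusOp b (a + ((i : ℝ) + 1) * b) d (c + ((i : ℝ) + 1) * d)
        (Tbrj^[k] φ) z).re| ≤
        43200 * M / F * |logGauge F x ((a + b) / (c + d)) - logGauge F x (b / d)| := by
  induction k with
  | zero =>
    intro a b c d h hFd _ N
    have hd := h.d_pos
    rw [pow_zero, one_mul] at hFd
    have hdist : d ^ 2 * |x - b / d| ≤ d * ‖(b : ℂ) - d * z‖ := by
      have e : ‖(b : ℂ) - d * z‖ = d * ‖z - ((b / d : ℝ) : ℂ)‖ := by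
        have hd0 : (d : ℂ) ≠ 0 := by exact_mod_cast hd.ne'
        have : (b : ℂ) - d * z = -(d * (z - ((b / d : ℝ) : ℂ))) := by
          push_cast
          field_simp
          ring
        rw [this, norm_neg, norm_mul, Complex.norm_real, Real.norm_eq_abs, abs_of_pos hd]
      rw [e, ← mul_assoc, ← sq]
      exact mul_le_mul_of_nonneg_left
        (hx _ (div_nonneg h.b_nonneg hd.le) ((div_le_one hd).2 h.b_le_d)) (by positivity)
    calc _ ≤ 5400 * M / (d * (1 + d * ‖(b : ℂ) - d * z‖)) :=
          sum_abs_re_moebiusOp_le hφ hM hb h hz N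
      _ ≤ 5400 * M / (d * (1 + d ^ 2 * |x - b / d|)) := by gcongr
      _ = 5400 * M * (1 / (d * (1 + d ^ 2 * |x - b / d|))) := by ring
      _ ≤ 5400 * M * (8 / F * |logGauge F x ((a + b) / (c + d)) - logGauge F x (b / d)|) := by
          gcongr
          exact h.le_abs_logGauge_sub hF hFd x
      _ = _ := by ring
  | succ k ih =>
    intro a b c d h hFd hgF N
    have hg := Real.goldenRatio_pos
    have hcd : F ≤ Real.goldenRatio ^ k * (c + d) := by
      rw [pow_succ', mul_assoc] at hgF
      exact le_of_mul_le_mul_left hgF hg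
    have hk : (0 : ℝ) < Real.goldenRatio ^ k := by positivity
    have hgk : Real.goldenRatio * F ≤ Real.goldenRatio ^ k * (d + (c + d)) := by
      have h1 : (Real.goldenRatio - 1) * F ≤
          (Real.goldenRatio - 1) * (Real.goldenRatio ^ (k + 1) * d) :=
        mul_le_mul_of_nonneg_left hFd (by linarith [Real.one_lt_goldenRatio])
      have h2 : (Real.goldenRatio - 1) * (Real.goldenRatio ^ (k + 1) * d) =
          Real.goldenRatio ^ k * d := by
        rw [pow_succ]
        linear_combination Real.goldenRatio ^ k * d * Real.goldenRatio_sq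
      linarith
    have hterm : ∀ i : ℕ, |(moebiusOp b (a + ((i : ℝ) + 1) * b) d (c + ((i : ℝ) + 1) * d)
        (Tbrj^[k + 1] φ) z).re| ≤ 43200 * M / F *
          |logGauge F x ((b + (a + ((i : ℝ) + 1) * b)) / (d + (c + ((i : ℝ) + 1) * d))) -
            logGauge F x ((a + ((i : ℝ) + 1) * b) / (c + ((i : ℝ) + 1) * d))| := by
      intro i
      have h' := h.mul_gmat i
      have hd := h.d_pos
      have hi : d ≤ ((i : ℝ) + 1) * d := le_mul_of_one_le_left hd.le (by simp)
      rw [Function.iterate_succ_apply']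
      refine abs_re_le_of_hasSum (hasSum_moebiusOp (iterate_Tbrj_mem_O1 hφ k) h.b_nonneg h.b_le_d
        hd h'.b_nonneg h'.b_le_d h'.d_pos hz) (ih _ _ _ _ h' (hcd.trans ?_) (hgk.trans ?_))
      · gcongr
      · gcongr
    refine (Finset.sum_le_sum fun i _ => hterm i).trans ?_
    rw [← Finset.mul_sum]
    gcongr
    exact h.sum_abs_sub_le (monotone_logGauge hF x) N

lemma abs_re_iterate_Tbrj_le {φ : ℂ → ℂ} (hφ : φ ∈ O1 0 1) {M : ℝ} (hM : 0 < M)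
    (hb : ∀ z ∈ cutPlane 0 1, |(φ z).re| ≤ M) {z : ℂ} (hz : z ∈ cutPlane 0 1) (k : ℕ) :
    |((Tbrj^[k] φ) z).re| ≤ 345600 * (1 + k) * ((√5 - 1) / 2) ^ k * M := by
  have hg := Real.goldenRatio_pos
  have hinv : (√5 - 1) / 2 = Real.goldenRatio⁻¹ := by
    rw [Real.inv_goldenRatio, Real.goldenConj]
    ring
  have hg1 := Real.one_lt_goldenRatio
  have hg2 := Real.goldenRatio_lt_two
  rw [hinv]
  cases k with
  | zero =>
    have := hb z hz
    simp only [Function.iterate_zero, id_eq, Nat.cast_zero, pow_zero]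
    linarith
  | succ j =>
    obtain ⟨x, hx0, hx1, hx⟩ := exists_mem_unit_abs_sub_le z
    set F := Real.goldenRatio ^ j * Real.goldenRatio⁻¹ with hFdef
    have hF : 0 < F := by positivity
    have hFj : F ≤ Real.goldenRatio ^ j :=
      mul_le_of_le_one_right (by positivity) (inv_le_one_of_one_le₀ hg1.le)
    have hid : IsAdmissible 1 0 0 1 := by constructor <;> norm_num
    have hsum := hasSum_Tterm (iterate_Tbrj_mem_O1 hφ j) hz
    simp_rw [← moebiusOp_zero_one_one _ _ (ne_zero_of_mem_cutPlane hz)] at hsum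
    have key := abs_re_le_of_hasSum hsum
      (sum_abs_re_moebiusOp_iterate_le hφ hM hb hz hF hx j 1 0 0 1 hid
        (by rwa [mul_one]) (by rw [hFdef]; field_simp; norm_num))
    have hpow : Real.goldenRatio ^ j ≤ 2 ^ j := pow_le_pow_left₀ hg.le hg2.le j
    have hlog : Real.log (1 + F) ≤ j + 1 := by
      have h1 : 1 + F ≤ 2 ^ (j + 1) := by
        have : (1 : ℝ) ≤ 2 ^ j := one_le_pow₀ one_le_two
        rw [pow_succ]
        linarith
      have h2 := Real.log_le_log (by positivity) h1
      rw [Real.log_pow] at h2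
      have h3 : ((j + 1 : ℕ) : ℝ) * Real.log 2 ≤ (j + 1 : ℕ) * 1 := by
        gcongr
        linarith [Real.log_two_lt_d9]
      push_cast at h2 h3
      linarith
    have hdiff : |logGauge F x ((1 + 0) / (0 + 1)) - logGauge F x (0 / 1)| ≤ 2 * (j + 1) := by
      norm_num only
      rw [abs_of_nonneg (sub_nonneg.2 (monotone_logGauge hF x zero_le_one))]
      linarith [logGauge_one_sub_zero_le hF hx0 hx1]
    rw [Function.iterate_succ_apply']
    refine key.trans ?_
    have hFinv : 1 / F = Real.goldenRatio ^ 2 * Real.goldenRatio⁻¹ ^ (j + 1) := by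
      rw [hFdef, inv_pow]
      clear_value F
      generalize Real.goldenRatio = g at hg
      field_simp
      ring
    have hsq : Real.goldenRatio ^ 2 ≤ 2 ^ 2 := pow_le_pow_left₀ hg.le hg2.le 2
    calc _ ≤ 43200 * M / F * (2 * (j + 1)) := by gcongr
      _ = 86400 * (j + 1) * (Real.goldenRatio ^ 2 * Real.goldenRatio⁻¹ ^ (j + 1)) * M := by
          rw [← hFinv]
          ring
      _ ≤ 86400 * (1 + (j + 1)) * (2 ^ 2 * Real.goldenRatio⁻¹ ^ (j + 1)) * M := by
          have : (j : ℝ) + 1 ≤ 1 + (j + 1) := by linarith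
          gcongr
      _ = _ := by
          push_cast
          ring

/-- spectral-radius estimate for `T` on functions of `𝒪¹(ℂ̄∖[0,1])`
with bounded real part (Proposition 4.11). -/
theorem T_spectral_estimate_bounded_real_part :
    ∃ C > 0, ∀ (k : ℕ), ∀ φ ∈ O1 0 1, ∀ M : ℝ,
      (∀ z ∈ cutPlane 0 1, |(φ z).re| ≤ M) →
        ∀ z ∈ cutPlane 0 1,
          |((Tbrj^[k] φ) z).re| ≤ C * (1 + k) * ((Real.sqrt 5 - 1) / 2) ^ k * M := by
  refine ⟨345600, by norm_num, fun k φ hφ M hM z hz => ?_⟩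
  have hM0 : 0 ≤ M := (abs_nonneg _).trans (hM z hz)
  have hlim : Tendsto (fun M' : ℝ => 345600 * (1 + (k : ℝ)) * ((Real.sqrt 5 - 1) / 2) ^ k * M')
      (𝓝[>] M) (𝓝 (345600 * (1 + (k : ℝ)) * ((Real.sqrt 5 - 1) / 2) ^ k * M)) :=
    ((continuous_const.mul continuous_id).tendsto M).mono_left nhdsWithin_le_nhds
  refine ge_of_tendsto hlim ?_
  filter_upwards [self_mem_nhdsWithin] with M' hM'
  exact abs_re_iterate_Tbrj_le hφ (hM0.trans_lt hM') (fun w hw => (hM w hw).trans (le_of_lt hM'))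
    hz k
end

section
/- The function z ↦ φ₁(z) + i·log(1 − z) (principal logarithm), which is well defined and holomorphic on the open upper half-plane ℍ = {z ∈ ℂ : Im z > 0}, extends to a continuous function on the closed upper half-plane {z : Im z ≥ 0}, and the value of this extension at z = 1 equals (1/π)·log 2 + 7π/12. -/
open Complex Filter Set Topology
open scoped ENNReal NNReal

noncomputable section

/-- The principal dilogarithm, `Li₂(z) = −∫₀¹ log(1 − tz)/t dt`. -/
def dilog (z : ℂ) : ℂ := -∫ t in (0 : ℝ)..1, Complex.log (1 - (t : ℂ) * z) / (t : ℂ)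

/-- The function `φ₁ = (L_{(1 1;0 1)} + L_{(0 1;1 1)}) φ₀`, explicitly
`φ₁(z) = (1/π)(z·Li₂(z/(1−z)) − Li₂(1/(z−1))) + (π/12)z + (1/π)·log 2`. -/
def phi1 (z : ℂ) : ℂ :=
  (Real.pi : ℂ)⁻¹ * (z * dilog (z / (1 - z)) - dilog (1 / (z - 1))) +
    ((Real.pi : ℝ) / 12 : ℝ) * z + (Real.pi : ℂ)⁻¹ * (Real.log 2 : ℝ)

end

theorem exists_tendsto_of_eventually_norm_deriv_le {f f' : ℂ → ℂ} {S : Set ℂ} (hS : Convex ℝ S)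
    (hf : ∀ z ∈ S, HasDerivAt f (f' z) z) {x : ℂ} {M : ℝ} (hM : ∀ᶠ z in 𝓝[S] x, ‖f' z‖ ≤ M) :
    ∃ y, Tendsto f (𝓝[S] x) (𝓝 y) := by
  obtain ⟨r, hr, hb⟩ := Metric.mem_nhdsWithin_iff.1 hM
  have hlip : LipschitzOnWith M.toNNReal f (Metric.ball x r ∩ S) := by
    refine ((convex_ball x r).inter hS).lipschitzOnWith_of_nnnorm_hasDerivWithin_le
      (fun z hz => (hf z hz.2).hasDerivWithinAt) fun z hz => ?_
    have h : ‖f' z‖ ≤ M := hb hz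
    rw [← NNReal.coe_le_coe, coe_nnnorm]
    exact h.trans (Real.le_coe_toNNReal M)
  obtain ⟨g, hg, hfg⟩ := hlip.extend_finite_dimension
  refine ⟨g x, (hg.continuous.continuousAt.tendsto.mono_left nhdsWithin_le_nhds).congr' ?_⟩
  filter_upwards [mem_nhdsWithin_of_mem_nhds (Metric.ball_mem_nhds x hr), self_mem_nhdsWithin]
    with z h1 h2
  exact (hfg ⟨h1, h2⟩).symm

theorem norm_log_le_abs_log_norm_add_pi (z : ℂ) : ‖Complex.log z‖ ≤ |Real.log ‖z‖| + Real.pi := by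
  have h := Complex.norm_le_abs_re_add_abs_im (Complex.log z)
  rw [Complex.log_re, Complex.log_im] at h
  linarith [Complex.abs_arg_le_pi z]

theorem tendsto_rpow_half_mul_abs_log_add_pi :
    Tendsto (fun z : ℂ => ‖z‖ ^ (1 / 2 : ℝ) * (|Real.log ‖z‖| + Real.pi)) (𝓝[≠] 0) (𝓝 0) := by
  have h1 : Tendsto (fun x : ℝ => x ^ (1 / 2 : ℝ)) (𝓝[>] 0) (𝓝 0) := by
    have := (Real.continuousAt_rpow_const 0 (1 / 2) (Or.inr (by norm_num))).tendsto
    rw [Real.zero_rpow (by norm_num)] at this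
    exact this.mono_left nhdsWithin_le_nhds
  have h2 := (tendsto_log_mul_rpow_nhdsGT_zero (r := 1 / 2) (by norm_num)).abs
  have h3 : Tendsto (fun x : ℝ => x ^ (1 / 2 : ℝ) * (|Real.log x| + Real.pi)) (𝓝[>] 0) (𝓝 0) := by
    have h4 := h2.add (h1.mul_const Real.pi)
    simp only [abs_zero, zero_mul, add_zero] at h4
    refine h4.congr' ?_
    filter_upwards [self_mem_nhdsWithin] with x hx
    have hx : (0 : ℝ) < x := hx
    rw [abs_mul, abs_of_nonneg (Real.rpow_nonneg hx.le _)]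
    ring
  exact h3.comp tendsto_norm_nhdsNE_zero

theorem tendsto_mul_log_sq :
    Tendsto (fun z : ℂ => z * Complex.log z ^ 2) (𝓝[≠] 0) (𝓝 0) := by
  have h := tendsto_rpow_half_mul_abs_log_add_pi.pow 2
  rw [zero_pow two_ne_zero] at h
  refine squeeze_zero_norm (fun z => ?_) h
  rw [norm_mul, norm_pow, mul_pow, ← Real.sqrt_eq_rpow, Real.sq_sqrt (norm_nonneg z)]
  have := norm_log_le_abs_log_norm_add_pi z
  gcongr

theorem tendsto_mul_log :
    Tendsto (fun z : ℂ => z * Complex.log z) (𝓝[≠] 0) (𝓝 0) := by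
  have h1 : Tendsto (fun z : ℂ => ‖z‖ ^ (1 / 2 : ℝ)) (𝓝[≠] 0) (𝓝 0) := by
    have := (continuous_norm.rpow_const (f := fun z : ℂ => ‖z‖) (p := 1 / 2)
      (fun _ => Or.inr (by norm_num))).tendsto 0
    rw [norm_zero, Real.zero_rpow (by norm_num)] at this
    exact this.mono_left nhdsWithin_le_nhds
  have h := h1.mul tendsto_rpow_half_mul_abs_log_add_pi
  rw [mul_zero] at h
  refine squeeze_zero_norm (fun z => ?_) h
  rw [norm_mul, ← mul_assoc, ← Real.rpow_add_of_nonneg (norm_nonneg z) (by norm_num) (by norm_num)]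
  have := norm_log_le_abs_log_norm_add_pi z
  norm_num
  gcongr

theorem tendsto_one_sub_nhdsNE : Tendsto (fun z : ℂ => 1 - z) (𝓝[≠] 1) (𝓝[≠] 0) := by
  refine tendsto_nhdsWithin_iff.2 ⟨?_, ?_⟩
  · have : ContinuousAt (fun z : ℂ => 1 - z) 1 := by fun_prop
    simpa [ContinuousAt] using this.tendsto.mono_left nhdsWithin_le_nhds
  · filter_upwards [self_mem_nhdsWithin] with z hz
    exact sub_ne_zero.2 (Ne.symm hz)

theorem log_isBigO_one_sub : Complex.log =O[𝓝 1] fun z : ℂ => 1 - z := by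
  have h := (Complex.hasDerivAt_log Complex.one_mem_slitPlane).isBigO_sub
  simp only [Complex.log_one, sub_zero] at h
  exact h.neg_right.congr_right fun z => neg_sub z 1

theorem tendsto_log_mul_log_one_sub :
    Tendsto (fun z : ℂ => Complex.log z * Complex.log (1 - z)) (𝓝[≠] 1) (𝓝 0) :=
  ((log_isBigO_one_sub.mono nhdsWithin_le_nhds).mul
    (Asymptotics.isBigO_refl (fun z : ℂ => Complex.log (1 - z)) _)).trans_tendsto
    (tendsto_mul_log.comp tendsto_one_sub_nhdsNE)

theorem dilog_zero : dilog 0 = 0 := by simp [dilog]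

theorem one_sub_ofReal_mul_mem_slitPlane {z : ℂ} (hz : 1 - z ∈ Complex.slitPlane) {t : ℝ}
    (ht : t ∈ Set.Icc (0 : ℝ) 1) : 1 - (t : ℂ) * z ∈ Complex.slitPlane := by
  have := StarConvex.add_smul_mem (y := -z) Complex.starConvex_one_slitPlane
    (by simpa [sub_eq_add_neg] using hz) ht.1 ht.2
  simpa [sub_eq_add_neg] using this

theorem intervalIntegrable_dilog {z : ℂ} (hz : 1 - z ∈ Complex.slitPlane) :
    IntervalIntegrable (fun t : ℝ => Complex.log (1 - (t : ℂ) * z) / (t : ℂ))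
      MeasureTheory.volume 0 1 := by
  have hd : ∀ t ∈ Set.Icc (0 : ℝ) 1,
      HasDerivAt (fun t : ℝ => Complex.log (1 - (t : ℂ) * z)) (-z / (1 - (t : ℂ) * z)) t := by
    intro t ht
    have h1 : HasDerivAt (fun t : ℝ => 1 - (t : ℂ) * z) (-z) t := by
      simpa using ((Complex.ofRealCLM.hasDerivAt (x := t)).mul_const z).const_sub 1
    exact h1.clog_real (one_sub_ofReal_mul_mem_slitPlane hz ht)
  have hc : ContinuousOn (dslope (fun t : ℝ => Complex.log (1 - (t : ℂ) * z)) 0)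
      (Set.uIcc 0 1) := by
    rw [Set.uIcc_of_le zero_le_one]
    intro t ht
    rcases eq_or_ne t 0 with rfl | h0
    · exact (continuousAt_dslope_same.2 (hd 0 ht).differentiableAt).continuousWithinAt
    · exact ((continuousAt_dslope_of_ne h0).2 (hd t ht).continuousAt).continuousWithinAt
  refine hc.intervalIntegrable.congr fun t ht => ?_
  rw [Set.uIoc_of_le zero_le_one] at ht
  rw [dslope_of_ne _ ht.1.ne']
  simp [slope_def_module, div_eq_inv_mul]

theorem isOpen_one_sub_mem_slitPlane : IsOpen {z : ℂ | 1 - z ∈ Complex.slitPlane} :=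
  Complex.isOpen_slitPlane.preimage (by fun_prop)

theorem hasDerivAt_dilog_integral {z : ℂ} (hz : 1 - z ∈ Complex.slitPlane) :
    HasDerivAt dilog (∫ t in (0 : ℝ)..1, (1 - (t : ℂ) * z)⁻¹) z := by
  obtain ⟨r, hr, hrs⟩ := Metric.nhds_basis_closedBall.mem_iff.1
    (isOpen_one_sub_mem_slitPlane.mem_nhds hz)
  have hK : IsCompact (Metric.closedBall z r ×ˢ Set.Icc (0 : ℝ) 1) :=
    (isCompact_closedBall z r).prod isCompact_Icc
  obtain ⟨C, hC⟩ := hK.exists_bound_of_continuousOn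
    (f := fun p : ℂ × ℝ => -(1 - (p.2 : ℂ) * p.1)⁻¹) (by
      refine ContinuousOn.neg (ContinuousOn.inv₀ (by fun_prop) ?_)
      rintro ⟨w, t⟩ ⟨hw, ht⟩
      exact Complex.slitPlane_ne_zero (one_sub_ofReal_mul_mem_slitPlane (hrs hw) ht))
  have key := (intervalIntegral.hasDerivAt_integral_of_dominated_loc_of_deriv_le
    (μ := MeasureTheory.volume) (a := 0) (b := 1)
    (F := fun (w : ℂ) (t : ℝ) => Complex.log (1 - (t : ℂ) * w) / (t : ℂ))
    (F' := fun (w : ℂ) (t : ℝ) => -(1 - (t : ℂ) * w)⁻¹) (bound := fun _ => C) (x₀ := z)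
    (Metric.closedBall_mem_nhds z hr) ?_ (intervalIntegrable_dilog hz) ?_ ?_
    intervalIntegrable_const ?_).2
  · have := key.neg
    rw [intervalIntegral.integral_neg, neg_neg] at this
    exact this
  · refine Filter.Eventually.of_forall fun w => Measurable.aestronglyMeasurable ?_
    fun_prop
  · refine Measurable.aestronglyMeasurable ?_
    fun_prop
  · refine Filter.Eventually.of_forall fun t ht w hw => ?_
    rw [Set.uIoc_of_le zero_le_one] at ht
    exact hC (w, t) ⟨hw, Set.Ioc_subset_Icc_self ht⟩
  · refine Filter.Eventually.of_forall fun t ht w hw => ?_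
    rw [Set.uIoc_of_le zero_le_one] at ht
    have ht0 : (t : ℂ) ≠ 0 := Complex.ofReal_ne_zero.2 ht.1.ne'
    have hm := one_sub_ofReal_mul_mem_slitPlane (hrs hw) (Set.Ioc_subset_Icc_self ht)
    have h1 : HasDerivAt (fun w : ℂ => 1 - (t : ℂ) * w) (-(t : ℂ)) w := by
      simpa using ((hasDerivAt_id w).const_mul (t : ℂ)).const_sub 1
    refine ((h1.clog hm).div_const (t : ℂ)).congr_deriv ?_
    field_simp [Complex.slitPlane_ne_zero hm]

theorem hasDerivAt_dilog {z : ℂ} (hz : 1 - z ∈ Complex.slitPlane) (h0 : z ≠ 0) :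
    HasDerivAt dilog (-Complex.log (1 - z) / z) z := by
  refine (hasDerivAt_dilog_integral hz).congr_deriv ?_
  have h := Complex.log_inv_eq_integral hz
  rw [Complex.log_inv _ (Complex.slitPlane_arg_ne_pi hz)] at h
  rw [h, mul_div_cancel_left₀ _ h0]
  simp only [Complex.real_smul]

theorem continuousAt_dilog {z : ℂ} (hz : 1 - z ∈ Complex.slitPlane) : ContinuousAt dilog z :=
  (hasDerivAt_dilog_integral hz).continuousAt

theorem one_sub_mem_slitPlane_of_im_ne_zero {z : ℂ} (hz : z.im ≠ 0) :
    1 - z ∈ Complex.slitPlane :=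
  Complex.mem_slitPlane_iff.2 (Or.inr (by simpa using hz))

theorem exists_tendsto_log_one_sub {S : Set ℂ} (hS : Convex ℝ S) (hS0 : ∀ z ∈ S, z.im ≠ 0)
    {x : ℂ} (hx : x ≠ 1) :
    ∃ y, Tendsto (fun z : ℂ => Complex.log (1 - z)) (𝓝[S] x) (𝓝 y) := by
  have hc : ContinuousAt (fun z : ℂ => ‖-1 / (1 - z)‖) x :=
    (continuousAt_const.div (by fun_prop) (sub_ne_zero.2 hx.symm)).norm
  refine exists_tendsto_of_eventually_norm_deriv_le (f' := fun z => -1 / (1 - z)) hS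
    (fun z hz => ?_) (M := ‖-1 / (1 - x)‖ + 1) ?_
  · exact ((hasDerivAt_id z).const_sub 1).clog (one_sub_mem_slitPlane_of_im_ne_zero (hS0 z hz))
  · exact nhdsWithin_le_nhds ((hc.eventually_lt_const (lt_add_one _)).mono fun _ h => h.le)

theorem exists_tendsto_dilog_one {S : Set ℂ} (hS : Convex ℝ S) (hS0 : ∀ z ∈ S, z.im ≠ 0) :
    ∃ y, Tendsto dilog (𝓝[S] 1) (𝓝 y) := by
  have hS1 : 𝓝[S] (1 : ℂ) ≤ 𝓝[≠] 1 := nhdsWithin_mono _ fun z hz h => hS0 z hz (by simp_all)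
  obtain ⟨c, hc⟩ := log_isBigO_one_sub.bound
  suffices h : ∃ y, Tendsto (fun z => dilog z + Complex.log z * Complex.log (1 - z))
      (𝓝[S] 1) (𝓝 y) by
    obtain ⟨y, hy⟩ := h
    exact ⟨y, by simpa using hy.sub (tendsto_log_mul_log_one_sub.mono_left hS1)⟩
  refine exists_tendsto_of_eventually_norm_deriv_le
    (f' := fun z => -Complex.log z / (1 - z)) hS (fun z hz => ?_) (M := c) ?_
  · have hm := one_sub_mem_slitPlane_of_im_ne_zero (hS0 z hz)
    have hz0 : z ≠ 0 := fun h => hS0 z hz (by simp [h])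
    have h1 := Complex.hasDerivAt_log (Complex.mem_slitPlane_iff.2 (Or.inr (hS0 z hz)))
    have h2 := ((hasDerivAt_id z).const_sub 1).clog hm
    refine ((hasDerivAt_dilog hm hz0).add (h1.mul h2)).congr_deriv ?_
    simp only [id]
    field_simp
    ring
  · filter_upwards [nhdsWithin_le_nhds hc, self_mem_nhdsWithin] with z hz hzS
    have hm := Complex.slitPlane_ne_zero (one_sub_mem_slitPlane_of_im_ne_zero (hS0 z hzS))
    rw [norm_div, norm_neg, div_le_iff₀ (norm_pos_iff.2 hm)]
    exact hz

theorem exists_tendsto_dilog {S : Set ℂ} (hS : Convex ℝ S) (hS0 : ∀ z ∈ S, z.im ≠ 0) (x : ℂ) :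
    ∃ y, Tendsto dilog (𝓝[S] x) (𝓝 y) := by
  rcases eq_or_ne x 1 with rfl | h1
  · exact exists_tendsto_dilog_one hS hS0
  rcases eq_or_ne x 0 with rfl | h0
  · exact ⟨_, (continuousAt_dilog (by simp)).tendsto.mono_left nhdsWithin_le_nhds⟩
  have hc : ContinuousAt (fun z : ℂ => (|Real.log ‖1 - z‖| + Real.pi) / ‖z‖) x := by
    refine ContinuousAt.div (ContinuousAt.add (ContinuousAt.abs (ContinuousAt.log ?_ ?_)) ?_) ?_ ?_
    · fun_prop
    · simpa using sub_ne_zero.2 h1.symm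
    · fun_prop
    · fun_prop
    · simpa using h0
  refine exists_tendsto_of_eventually_norm_deriv_le (f' := fun z => -Complex.log (1 - z) / z) hS
    (fun z hz => hasDerivAt_dilog (one_sub_mem_slitPlane_of_im_ne_zero (hS0 z hz)) ?_)
    (M := (|Real.log ‖1 - x‖| + Real.pi) / ‖x‖ + 1) ?_
  · rintro rfl
    exact hS0 0 hz rfl
  · refine nhdsWithin_le_nhds ((hc.eventually_lt_const (lt_add_one _)).mono fun z hz => ?_)
    refine le_trans ?_ hz.le
    rw [norm_div, norm_neg]
    gcongr
    exact norm_log_le_abs_log_norm_add_pi _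

theorem one_add_mem_slitPlane {s : ℂ} (hs : s ∈ Complex.slitPlane) :
    1 + s ∈ Complex.slitPlane := by
  rw [Complex.mem_slitPlane_iff] at hs ⊢
  simp only [Complex.add_re, Complex.one_re, Complex.add_im, Complex.one_im, zero_add]
  exact hs.imp (fun h => by linarith) id

theorem inv_mem_slitPlane {s : ℂ} (hs : s ∈ Complex.slitPlane) : s⁻¹ ∈ Complex.slitPlane := by
  have h0 := Complex.normSq_pos.2 (Complex.slitPlane_ne_zero hs)
  rw [Complex.mem_slitPlane_iff] at hs ⊢
  rw [Complex.inv_re, Complex.inv_im]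
  exact hs.imp (fun h => by positivity) fun h => div_ne_zero (neg_ne_zero.2 h) h0.ne'

theorem eqOn_const_slitPlane {g : ℂ → ℂ} (hg : ∀ s ∈ Complex.slitPlane, HasDerivAt g 0 s) {s : ℂ}
    (hs : s ∈ Complex.slitPlane) : g s = g 1 :=
  Complex.isOpen_slitPlane.is_const_of_deriv_eq_zero
    (Complex.starConvex_one_slitPlane.isPathConnected Complex.one_mem_slitPlane
      ).isConnected.isPreconnected
    (fun z hz => (hg z hz).differentiableAt.differentiableWithinAt)
    (fun z hz => (hg z hz).deriv) hs Complex.one_mem_slitPlane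

theorem log_one_add_inv {s : ℂ} (hs : s ∈ Complex.slitPlane) :
    Complex.log (1 + s⁻¹) = Complex.log (1 + s) - Complex.log s := by
  have h := eqOn_const_slitPlane
    (g := fun s => Complex.log (1 + s⁻¹) - Complex.log (1 + s) + Complex.log s) ?_ hs
  · simp only [inv_one, sub_self, Complex.log_one, add_zero] at h
    linear_combination h
  · intro s hs
    have h0 := Complex.slitPlane_ne_zero hs
    have h1 := Complex.slitPlane_ne_zero (one_add_mem_slitPlane hs)
    have h2 := Complex.slitPlane_ne_zero (one_add_mem_slitPlane (inv_mem_slitPlane hs))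
    have d1 := ((hasDerivAt_inv h0).const_add 1).clog
      (one_add_mem_slitPlane (inv_mem_slitPlane hs))
    have d2 := ((hasDerivAt_id s).const_add 1).clog (one_add_mem_slitPlane hs)
    refine ((d1.sub d2).add (Complex.hasDerivAt_log hs)).congr_deriv ?_
    have h3 : 1 + s⁻¹ = (1 + s) / s := by field_simp; ring
    simp only [id, h3]
    field_simp
    ring

theorem dilog_neg_add_dilog_neg_inv {s : ℂ} (hs : s ∈ Complex.slitPlane) :
    dilog (-s) + dilog (-s⁻¹) + Complex.log s ^ 2 / 2 = 2 * dilog (-1) := by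
  have h := eqOn_const_slitPlane
    (g := fun s => dilog (-s) + dilog (-s⁻¹) + Complex.log s ^ 2 / 2) ?_ hs
  · simp only [inv_one, Complex.log_one] at h
    linear_combination h
  · intro s hs
    have h0 := Complex.slitPlane_ne_zero hs
    have hi := inv_mem_slitPlane hs
    have d1 := (hasDerivAt_dilog (z := -s) (by simpa using one_add_mem_slitPlane hs)
      (neg_ne_zero.2 h0)).comp s (hasDerivAt_neg s)
    have d2 := (hasDerivAt_dilog (z := -s⁻¹) (by simpa using one_add_mem_slitPlane hi)
      (neg_ne_zero.2 (inv_ne_zero h0))).comp s (hasDerivAt_inv h0).neg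
    have d3 := ((Complex.hasDerivAt_log hs).pow 2).div_const 2
    refine ((d1.add d2).add d3).congr_deriv ?_
    simp only [sub_neg_eq_add, log_one_add_inv hs]
    field_simp
    ring

theorem convex_upperHalf : Convex ℝ {z : ℂ | 0 < z.im} := convex_halfSpace_im_gt 0

theorem im_one_div_sub_one_neg {z : ℂ} (hz : 0 < z.im) : (1 / (z - 1)).im < 0 := by
  have h : 0 < (z - 1).im := by simpa using hz
  have h0 : 0 < Complex.normSq (z - 1) := Complex.normSq_pos.2 fun h' => by simp [h'] at h
  rw [one_div, Complex.inv_im]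
  exact div_neg_of_neg_of_pos (neg_neg_of_pos h) h0

theorem im_div_one_sub_pos {z : ℂ} (hz : 0 < z.im) : 0 < (z / (1 - z)).im := by
  have h1 : z ≠ 1 := fun h => by simp [h] at hz
  have h : z / (1 - z) = -1 - 1 / (z - 1) := by
    have := sub_ne_zero.2 h1
    have := sub_ne_zero.2 h1.symm
    field_simp
    ring
  rw [h]
  simpa using im_one_div_sub_one_neg hz

theorem differentiableOn_phi1_add_log :
    DifferentiableOn ℂ (fun z => phi1 z + Complex.I * Complex.log (1 - z))
      {z : ℂ | 0 < z.im} := by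
  intro z hz
  have hz : 0 < z.im := hz
  have h1 : z ≠ 1 := fun h => by simp [h] at hz
  have hw1 := (hasDerivAt_dilog_integral (one_sub_mem_slitPlane_of_im_ne_zero
    (im_div_one_sub_pos hz).ne')).differentiableAt
  have hw2 := (hasDerivAt_dilog_integral (one_sub_mem_slitPlane_of_im_ne_zero
    (im_one_div_sub_one_neg hz).ne)).differentiableAt
  have d1 : DifferentiableAt ℂ (fun z => dilog (z / (1 - z))) z :=
    DifferentiableAt.comp (f := fun z : ℂ => z / (1 - z)) z hw1
      (differentiableAt_id.div (by fun_prop) (sub_ne_zero.2 h1.symm))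
  have d2 : DifferentiableAt ℂ (fun z => dilog (1 / (z - 1))) z :=
    DifferentiableAt.comp (f := fun z : ℂ => 1 / (z - 1)) z hw2
      ((differentiableAt_const 1).div (by fun_prop) (sub_ne_zero.2 h1))
  have d3 : DifferentiableAt ℂ (fun z : ℂ => Complex.log (1 - z)) z :=
    DifferentiableAt.clog (by fun_prop) (one_sub_mem_slitPlane_of_im_ne_zero hz.ne')
  unfold phi1
  exact DifferentiableAt.differentiableWithinAt (by fun_prop)

theorem exists_tendsto_phi1_add_log {x : ℂ} (hx : x ≠ 1) :
    ∃ y, Tendsto (fun z => phi1 z + Complex.I * Complex.log (1 - z)) (𝓝[{z : ℂ | 0 < z.im}] x)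
      (𝓝 y) := by
  have hx1 := sub_ne_zero.2 hx
  have hx2 := sub_ne_zero.2 hx.symm
  have t1 : Tendsto (fun z : ℂ => z / (1 - z)) (𝓝[{z : ℂ | 0 < z.im}] x)
      (𝓝[{z : ℂ | 0 < z.im}] (x / (1 - x))) := by
    refine tendsto_nhdsWithin_iff.2 ⟨?_, ?_⟩
    · have hc : ContinuousAt (fun z : ℂ => z / (1 - z)) x := by fun_prop (disch := exact hx2)
      exact hc.tendsto.mono_left nhdsWithin_le_nhds
    · filter_upwards [self_mem_nhdsWithin] with z hz using im_div_one_sub_pos hz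
  have t2 : Tendsto (fun z : ℂ => 1 / (z - 1)) (𝓝[{z : ℂ | 0 < z.im}] x)
      (𝓝[{z : ℂ | z.im < 0}] (1 / (x - 1))) := by
    refine tendsto_nhdsWithin_iff.2 ⟨?_, ?_⟩
    · have hc : ContinuousAt (fun z : ℂ => 1 / (z - 1)) x := by fun_prop (disch := exact hx1)
      exact hc.tendsto.mono_left nhdsWithin_le_nhds
    · filter_upwards [self_mem_nhdsWithin] with z hz using im_one_div_sub_one_neg hz
  have t3 : Tendsto (fun z : ℂ => z) (𝓝[{z : ℂ | 0 < z.im}] x) (𝓝 x) := nhdsWithin_le_nhds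
  obtain ⟨y1, h1⟩ := exists_tendsto_dilog convex_upperHalf (fun z hz => (ne_of_gt hz))
    (x / (1 - x))
  obtain ⟨y2, h2⟩ := exists_tendsto_dilog (convex_halfSpace_im_lt 0) (fun z hz => (ne_of_lt hz))
    (1 / (x - 1))
  obtain ⟨y3, h3⟩ := exists_tendsto_log_one_sub convex_upperHalf (fun z hz => (ne_of_gt hz)) hx
  unfold phi1
  exact ⟨_, (((((t3.mul (h1.comp t1)).sub (h2.comp t2)).const_mul _).add (t3.const_mul _)).add
    tendsto_const_nhds).add (h3.const_mul _)⟩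

theorem phi1_add_log_eq {z : ℂ} (hz : 0 < z.im) :
    phi1 z + Complex.I * Complex.log (1 - z) =
      (Real.pi : ℂ)⁻¹ * ((z - 1) * (2 * dilog (-1)) - z * dilog ((1 - z) / z) + dilog (z - 1) +
          (1 - z) * Complex.log (1 - z) ^ 2 / 2 -
          z / 2 * (Complex.log z ^ 2 - (Real.pi : ℂ) ^ 2 -
            2 * (Complex.log z * Complex.log (1 - z)) -
            2 * Complex.I * Real.pi * Complex.log z)) +
        Complex.I * ((1 - z) * Complex.log (1 - z)) + ((Real.pi : ℝ) / 12 : ℝ) * z +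
        (Real.pi : ℂ)⁻¹ * (Real.log 2 : ℝ) := by
  have hz1 : z - 1 ∈ Complex.slitPlane :=
    Complex.mem_slitPlane_iff.2 (Or.inr (by simpa using hz.ne'))
  have hz2 := one_sub_mem_slitPlane_of_im_ne_zero hz.ne'
  have h1 := Complex.slitPlane_ne_zero hz1
  have h2 := Complex.slitPlane_ne_zero hz2
  have h0 : z ≠ 0 := fun h => by simp [h] at hz
  have hpi : (Real.pi : ℂ) ≠ 0 := Complex.ofReal_ne_zero.2 Real.pi_ne_zero
  have hlog : Complex.log (z - 1) = Complex.log (1 - z) + Complex.I * Real.pi := by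
    have him : 0 < (z - 1).im := by simpa using hz
    have h := Complex.arg_neg_eq_arg_sub_pi_of_im_pos him
    rw [neg_sub] at h
    simp only [Complex.log, h, norm_sub_rev 1 z]
    push_cast
    ring
  have e1 := dilog_neg_add_dilog_neg_inv (one_add_mem_slitPlane (inv_mem_slitPlane hz1))
  rw [log_one_add_inv hz1, hlog, add_sub_cancel,
    show -(1 + (z - 1)⁻¹) = z / (1 - z) by field_simp; ring,
    show -(1 + (z - 1)⁻¹)⁻¹ = (1 - z) / z by
      rw [show 1 + (z - 1)⁻¹ = z / (z - 1) by field_simp; ring, inv_div, ← neg_div, neg_sub]] at e1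
  have e2 := dilog_neg_add_dilog_neg_inv (inv_mem_slitPlane hz2)
  rw [Complex.log_inv _ (Complex.slitPlane_arg_ne_pi hz2), inv_inv, neg_sub,
    show -(1 - z)⁻¹ = 1 / (z - 1) by rw [← inv_neg, neg_sub, one_div]] at e2
  rw [phi1, eq_sub_of_add_eq (eq_sub_of_add_eq e1), eq_sub_of_add_eq (eq_sub_of_add_eq e2)]
  field_simp
  ring_nf
  simp only [Complex.I_sq]
  ring

theorem tendsto_phi1_add_log_one :
    Tendsto (fun z => phi1 z + Complex.I * Complex.log (1 - z)) (𝓝[{z : ℂ | 0 < z.im}] 1)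
      (𝓝 ((Real.pi : ℂ)⁻¹ * (Real.log 2 : ℝ) + (7 * Real.pi / 12 : ℝ))) := by
  have hS1 : 𝓝[{z : ℂ | 0 < z.im}] (1 : ℂ) ≤ 𝓝[≠] 1 :=
    nhdsWithin_mono _ fun z hz h => by
      have : 0 < z.im := hz
      simp_all
  have hpi : (Real.pi : ℂ) ≠ 0 := Complex.ofReal_ne_zero.2 Real.pi_ne_zero
  have t : Tendsto (fun z : ℂ => z) (𝓝[{z : ℂ | 0 < z.im}] 1) (𝓝 1) := nhdsWithin_le_nhds
  have tl : Tendsto Complex.log (𝓝[{z : ℂ | 0 < z.im}] 1) (𝓝 0) := by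
    simpa using (continuousAt_clog Complex.one_mem_slitPlane).tendsto.mono_left nhdsWithin_le_nhds
  have td : Tendsto dilog (𝓝 0) (𝓝 0) := by
    simpa [ContinuousAt, dilog_zero] using continuousAt_dilog (z := 0) (by simp)
  have td1 : Tendsto (fun z : ℂ => dilog ((1 - z) / z)) (𝓝[{z : ℂ | 0 < z.im}] 1) (𝓝 0) := by
    have hc : ContinuousAt (fun z : ℂ => (1 - z) / z) 1 := by
      fun_prop (disch := exact one_ne_zero)
    refine td.comp ?_
    simpa [ContinuousAt] using hc.tendsto.mono_left nhdsWithin_le_nhds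
  have td2 : Tendsto (fun z : ℂ => dilog (z - 1)) (𝓝[{z : ℂ | 0 < z.im}] 1) (𝓝 0) := by
    refine td.comp ?_
    simpa using t.sub_const 1
  have tA := (tendsto_mul_log_sq.comp tendsto_one_sub_nhdsNE).mono_left hS1
  have tB := (tendsto_mul_log.comp tendsto_one_sub_nhdsNE).mono_left hS1
  have tC := tendsto_log_mul_log_one_sub.mono_left hS1
  have key := ((((((((t.sub_const 1).mul_const (2 * dilog (-1))).sub (t.mul td1)).add td2).add
    (tA.div_const 2)).sub ((t.div_const 2).mul ((((tl.pow 2).sub_const ((Real.pi : ℂ) ^ 2)).sub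
      (tC.const_mul 2)).sub (tl.const_mul (2 * Complex.I * Real.pi))))).const_mul
      (Real.pi : ℂ)⁻¹).add (tB.const_mul Complex.I)).add
      (t.const_mul (((Real.pi : ℝ) / 12 : ℝ) : ℂ)) |>.add_const
        ((Real.pi : ℂ)⁻¹ * (Real.log 2 : ℝ))
  refine (key.congr' ?_).trans_eq ?_
  · filter_upwards [self_mem_nhdsWithin] with z hz using (phi1_add_log_eq hz).symm
  · congr 1
    push_cast
    field_simp
    ring

/-- `φ₁(z) + i·log(1 − z)` is holomorphic on the upper half-plane and
extends continuously to the closed upper half-plane, with value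
`(1/π)·log 2 + 7π/12` at `z = 1` (Lemma 5.2). -/
theorem phi1_plus_ilog_extends_continuously :
    DifferentiableOn ℂ (fun z => phi1 z + Complex.I * Complex.log (1 - z))
        {z : ℂ | 0 < z.im} ∧
      ∃ F : ℂ → ℂ, ContinuousOn F {z : ℂ | 0 ≤ z.im} ∧
        (∀ z : ℂ, 0 < z.im → F z = phi1 z + Complex.I * Complex.log (1 - z)) ∧
        F 1 = (Real.pi : ℂ)⁻¹ * (Real.log 2 : ℝ) + (7 * Real.pi / 12 : ℝ) := by
  have hcl : {z : ℂ | 0 ≤ z.im} ⊆ closure {z : ℂ | 0 < z.im} :=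
    (Complex.closure_setOfPred_lt_im 0).ge
  refine ⟨differentiableOn_phi1_add_log, extendFrom {z : ℂ | 0 < z.im}
    (fun z => phi1 z + Complex.I * Complex.log (1 - z)), ?_, fun z hz => ?_, ?_⟩
  · refine continuousOn_extendFrom hcl fun x _ => ?_
    rcases eq_or_ne x 1 with rfl | hx
    · exact ⟨_, tendsto_phi1_add_log_one⟩
    · exact exists_tendsto_phi1_add_log hx
  · exact extendFrom_eq (subset_closure hz) (differentiableOn_phi1_add_log z hz).continuousWithinAt
  · exact extendFrom_eq (hcl (by simp)) tendsto_phi1_add_log_one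
end

section
/- The real part of φ₁ is bounded on ℂ∖[1/2,2], i.e. sup_{z∈ℂ∖[1/2,2]} |Re φ₁(z)| < ∞. Moreover there exists a bounded continuous function F : ℂ∖{1} → ℝ such that F(z) = Re φ₁(z) for every z ∈ ℂ∖[1/2,2], and the one-sided limits of F along the real axis at 1 are lim_{x→1⁺, x∈ℝ} F(x) = (1/π)·log 2 + π/12 − π/2 and lim_{x→1⁻, x∈ℝ} F(x) = (1/π)·log 2 + π/12 + π/2. -/
open Complex Filter Set Topology
open scoped ENNReal NNReal

noncomputable section

open MeasureTheory intervalIntegral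

/-- For `‖u‖ = 1` and `0 < τ`, a bound for `|log ‖1 - τ u‖| / τ` independent of `u`. -/
def logKernelBound (τ : ℝ) : ℝ := 3 + 2 * |Real.log (1 - τ)|

/-- The real part of the integrand defining `-dilog u`. -/
def logKernel (u : ℂ) (τ : ℝ) : ℝ := Real.log ‖1 - (τ : ℂ) * u‖ / τ

lemma abs_log_norm_one_sub_le {w : ℂ} (hw : ‖w‖ ≠ 1) :
    |Real.log ‖1 - w‖| ≤ ‖w‖ * logKernelBound ‖w‖ := by
  have h0 : 0 ≤ ‖w‖ := norm_nonneg w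
  have h1 : 0 < |1 - ‖w‖| := abs_pos.mpr (sub_ne_zero.mpr (Ne.symm hw))
  have h2 : |1 - ‖w‖| ≤ ‖1 - w‖ := by simpa using abs_norm_sub_norm_le 1 w
  have h3 : ‖1 - w‖ ≤ 1 + ‖w‖ := by simpa using norm_sub_le 1 w
  have h4 : Real.log (1 - ‖w‖) ≤ Real.log ‖1 - w‖ := by
    rw [← Real.log_abs (1 - ‖w‖)]; exact Real.log_le_log h1 h2
  have h5 : Real.log ‖1 - w‖ ≤ ‖w‖ := by
    have := Real.log_le_sub_one_of_pos (h1.trans_le h2)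
    linarith
  have h6 : 0 ≤ |Real.log (1 - ‖w‖)| := abs_nonneg _
  have h7 : -|Real.log (1 - ‖w‖)| ≤ Real.log (1 - ‖w‖) := neg_abs_le _
  unfold logKernelBound
  rw [abs_le]
  constructor
  · rcases le_or_gt ‖w‖ (1 / 2) with h | h
    · have h8 : 0 < 1 - ‖w‖ := by linarith
      have h9 := Real.one_sub_inv_le_log_of_pos h8
      have h10 : (1 - ‖w‖)⁻¹ ≤ 1 + 2 * ‖w‖ := by
        rw [inv_le_iff_one_le_mul₀ h8]; nlinarith
      nlinarith
    · nlinarith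
  · nlinarith

lemma abs_arg_one_sub_le (w : ℂ) : |(1 - w).arg| ≤ 2 * Real.pi * ‖w‖ := by
  rcases le_or_gt ‖w‖ (1 / 2) with h | h
  · have h1 : ‖Complex.log (1 + -w)‖ ≤ 3 / 2 * ‖-w‖ :=
      Complex.norm_log_one_add_half_le_self (by simpa using h)
    have h2 := (Complex.abs_im_le_norm _).trans h1
    rw [Complex.log_im, norm_neg, ← sub_eq_add_neg] at h2
    nlinarith [Real.pi_gt_three, norm_nonneg w]
  · nlinarith [Real.pi_pos, Complex.abs_arg_le_pi (1 - w)]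

lemma intervalIntegrable_logKernelBound (a b : ℝ) :
    IntervalIntegrable logKernelBound volume a b := by
  have h : IntervalIntegrable (fun τ => Real.log (1 - τ)) volume a b := by
    have := (intervalIntegrable_log' (a := 1 - a) (b := 1 - b)).comp_sub_left 1
    simpa using this
  exact intervalIntegrable_const.add (h.abs.const_mul 2)

lemma abs_logKernel_le {u : ℂ} {τ : ℝ} (hτ : 0 < τ) (h : τ * ‖u‖ ≠ 1) :
    |logKernel u τ| ≤ ‖u‖ * logKernelBound (τ * ‖u‖) := by
  have hn : ‖(τ : ℂ) * u‖ = τ * ‖u‖ := by simp [abs_of_pos hτ]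
  have := abs_log_norm_one_sub_le (w := (τ : ℂ) * u) (by rwa [hn])
  rw [hn] at this
  rw [logKernel, abs_div, abs_of_pos hτ, div_le_iff₀ hτ]
  linarith

lemma measurable_logKernel (u : ℂ) : Measurable (logKernel u) := by
  unfold logKernel; fun_prop

lemma ae_mul_ne_one (c : ℝ) : ∀ᵐ τ : ℝ, τ * c ≠ 1 := by
  rcases eq_or_ne c 0 with rfl | hc
  · simp
  · filter_upwards [Measure.ae_ne volume c⁻¹] with τ h h'
    exact h (eq_inv_of_mul_eq_one_left h')

lemma intervalIntegrable_logKernel (u : ℂ) {a b : ℝ} (ha : 0 ≤ a) (hb : 0 ≤ b) :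
    IntervalIntegrable (logKernel u) volume a b := by
  rcases eq_or_ne u 0 with rfl | hu
  · have : logKernel 0 = fun _ => 0 := by ext; simp [logKernel]
    rw [this]; exact intervalIntegrable_const
  · have h : IntervalIntegrable (fun τ => ‖u‖ * logKernelBound (τ * ‖u‖)) volume a b := by
      have := (intervalIntegrable_logKernelBound (a * ‖u‖) (b * ‖u‖)).comp_mul_right
        (c := ‖u‖)
      rw [mul_div_cancel_right₀ _ (norm_ne_zero_iff.mpr hu),
        mul_div_cancel_right₀ _ (norm_ne_zero_iff.mpr hu)] at this
      exact this.const_mul _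
    refine h.mono_fun' (measurable_logKernel u).aestronglyMeasurable ?_
    filter_upwards [ae_restrict_of_ae (ae_mul_ne_one ‖u‖),
      ae_restrict_mem measurableSet_uIoc] with τ h1 h2
    exact abs_logKernel_le ((le_min ha hb).trans_lt h2.1) h1

lemma intervalIntegrable_dilog_integrand (z : ℂ) :
    IntervalIntegrable (fun t : ℝ => Complex.log (1 - (t : ℂ) * z) / (t : ℂ)) volume 0 1 := by
  have h : IntervalIntegrable (fun t => |logKernel z t| + 2 * Real.pi * ‖z‖) volume 0 1 :=
    (intervalIntegrable_logKernel z le_rfl zero_le_one).abs.add intervalIntegrable_const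
  refine h.mono_fun' (Measurable.aestronglyMeasurable (by fun_prop)) ?_
  filter_upwards [ae_restrict_mem measurableSet_uIoc] with t ht
  rw [uIoc_of_le zero_le_one] at ht
  have h1 := Complex.norm_le_abs_re_add_abs_im (Complex.log (1 - (t : ℂ) * z))
  rw [Complex.log_re, Complex.log_im] at h1
  have h2 := abs_arg_one_sub_le ((t : ℂ) * z)
  rw [norm_mul, Complex.norm_real, Real.norm_eq_abs, abs_of_pos ht.1] at h2
  rw [norm_div, Complex.norm_real, Real.norm_eq_abs, abs_of_pos ht.1, logKernel, abs_div,
    abs_of_pos ht.1, div_le_iff₀ ht.1, add_mul, div_mul_cancel₀ _ ht.1.ne']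
  nlinarith

lemma re_dilog (z : ℂ) : (dilog z).re = -∫ t in (0 : ℝ)..1, logKernel z t := by
  rw [dilog, Complex.neg_re, ← Complex.reCLM_apply,
    ← Complex.reCLM.intervalIntegral_comp_comm (intervalIntegrable_dilog_integrand z)]
  simp [logKernel, Complex.log_re, Complex.div_ofReal_re]

lemma im_dilog (z : ℂ) :
    (dilog z).im = -∫ t in (0 : ℝ)..1, (1 - (t : ℂ) * z).arg / t := by
  rw [dilog, Complex.neg_im, ← Complex.imCLM_apply,
    ← Complex.imCLM.intervalIntegral_comp_comm (intervalIntegrable_dilog_integrand z)]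
  simp [Complex.log_im, Complex.div_ofReal_im]

lemma abs_arg_div_le {t : ℝ} (ht : 0 < t) (z : ℂ) :
    |(1 - (t : ℂ) * z).arg / t| ≤ 2 * Real.pi * ‖z‖ := by
  have h := abs_arg_one_sub_le ((t : ℂ) * z)
  rw [norm_mul, Complex.norm_real, Real.norm_eq_abs, abs_of_pos ht] at h
  rw [abs_div, abs_of_pos ht, div_le_iff₀ ht]
  linarith

lemma abs_im_dilog_le (z : ℂ) : |(dilog z).im| ≤ 2 * Real.pi * ‖z‖ := by
  rw [im_dilog, abs_neg]
  have := norm_integral_le_of_norm_le_const (a := 0) (b := 1)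
    (f := fun t : ℝ => (1 - (t : ℂ) * z).arg / t) (C := 2 * Real.pi * ‖z‖) (fun t ht => by
      rw [uIoc_of_le zero_le_one] at ht
      exact abs_arg_div_le ht.1 z)
  simpa using this

lemma continuousAt_im_dilog {z : ℂ} (hz : z.im ≠ 0) :
    ContinuousAt (fun w => (dilog w).im) z := by
  simp only [im_dilog]
  refine (continuousAt_of_dominated_interval (bound := fun _ => 2 * Real.pi * (‖z‖ + 1))
    ?_ ?_ intervalIntegrable_const ?_).neg
  · exact Eventually.of_forall fun w => Measurable.aestronglyMeasurable
      (by fun_prop)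
  · have : ∀ᶠ w in 𝓝 z, ‖w‖ < ‖z‖ + 1 :=
      continuous_norm.continuousAt.eventually_lt continuousAt_const (by linarith)
    filter_upwards [this] with w hw
    refine Eventually.of_forall fun t ht => ?_
    rw [uIoc_of_le zero_le_one] at ht
    refine (abs_arg_div_le ht.1 w).trans ?_
    have := Real.pi_pos
    gcongr
  · refine Eventually.of_forall fun t ht => ?_
    rw [uIoc_of_le zero_le_one] at ht
    have h : (1 - (t : ℂ) * z) ∈ slitPlane := by
      right
      simpa using ⟨ht.1.ne', hz⟩
    refine ContinuousAt.div_const ?_ _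
    exact ContinuousAt.comp (f := fun w : ℂ => 1 - (t : ℂ) * w) (continuousAt_arg h) (by fun_prop)

lemma re_dilog_ofReal_mul (r : ℝ) (u : ℂ) :
    (dilog (r * u)).re = -∫ τ in (0 : ℝ)..r, logKernel u τ := by
  rw [re_dilog]
  have h := mul_integral_comp_mul_left (a := 0) (b := 1) (f := logKernel u) r
  rw [mul_zero, mul_one, ← intervalIntegral.integral_const_mul] at h
  rw [← h]
  congr 2
  ext t
  rcases eq_or_ne r 0 with rfl | hr
  · simp [logKernel]
  · simp only [logKernel, ofReal_mul]
    rw [show (t : ℂ) * (r * u) = r * t * u by ring, mul_div_assoc']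
    rw [mul_div_mul_left _ _ hr]

lemma re_dilog_polar (z : ℂ) :
    (dilog z).re = -∫ τ in (0 : ℝ)..‖z‖, logKernel (z / ‖z‖) τ := by
  rw [← re_dilog_ofReal_mul]
  rcases eq_or_ne z 0 with rfl | hz
  · simp
  · rw [mul_div_cancel₀]
    exact_mod_cast norm_ne_zero_iff.mpr hz

lemma abs_logKernel_le_of_norm_eq_one {u : ℂ} (hu : ‖u‖ = 1) {τ : ℝ} (hτ : 0 < τ) (h : τ ≠ 1) :
    |logKernel u τ| ≤ logKernelBound τ := by
  simpa [hu] using abs_logKernel_le (u := u) hτ (by simpa [hu] using h)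

lemma norm_div_norm_self {z : ℂ} (hz : z ≠ 0) : ‖z / ‖z‖‖ = 1 := by
  simp [hz]

lemma abs_integral_logKernel_le {u : ℂ} (hu : ‖u‖ = 1) {r : ℝ} (hr : 0 ≤ r) :
    |∫ τ in (0 : ℝ)..r, logKernel u τ| ≤ ∫ τ in (0 : ℝ)..r, logKernelBound τ := by
  rw [← Real.norm_eq_abs]
  refine intervalIntegral.norm_integral_le_of_norm_le hr ?_ (intervalIntegrable_logKernelBound 0 r)
  filter_upwards [Measure.ae_ne volume 1] with τ h1 h2
  exact abs_logKernel_le_of_norm_eq_one hu h2.1 h1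

lemma abs_re_dilog_le_integral (z : ℂ) :
    |(dilog z).re| ≤ ∫ τ in (0 : ℝ)..‖z‖, logKernelBound τ := by
  rcases eq_or_ne z 0 with rfl | hz
  · simp [re_dilog_polar]
  · rw [re_dilog_polar, abs_neg]
    exact abs_integral_logKernel_le (norm_div_norm_self hz) (norm_nonneg z)

lemma continuous_re_dilog : Continuous fun z => (dilog z).re := by
  rw [continuous_iff_continuousAt]
  intro z
  rcases eq_or_ne z 0 with rfl | hz
  · have h : Tendsto (fun z : ℂ => ∫ τ in (0 : ℝ)..‖z‖, logKernelBound τ) (𝓝 0) (𝓝 0) := by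
      have := ((continuous_primitive intervalIntegrable_logKernelBound 0).comp
        (continuous_norm (E := ℂ))).tendsto 0
      simpa [Function.comp_def] using this
    rw [ContinuousAt, show (dilog 0).re = 0 by simp [re_dilog_polar]]
    exact squeeze_zero_norm abs_re_dilog_le_integral h
  have hrw : ∀ w ∈ Metric.ball z 1, (dilog w).re = -∫ τ in Ioc 0 (‖z‖ + 1),
      (Ioc 0 ‖w‖).indicator (logKernel (w / ‖w‖)) τ := by
    intro w hw
    have hw' : ‖w‖ ≤ ‖z‖ + 1 := by
      have := norm_sub_norm_le w z
      rw [mem_ball_iff_norm] at hw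
      linarith
    rw [re_dilog_polar, integral_of_le (norm_nonneg w), setIntegral_indicator measurableSet_Ioc,
      inter_eq_right.mpr (Ioc_subset_Ioc_right hw')]
  have hball := Metric.ball_mem_nhds z one_pos
  refine ContinuousAt.congr ?_ (eventually_of_mem hball fun w hw => (hrw w hw).symm)
  have hne : ∀ᶠ w in 𝓝 z, w ≠ 0 := isOpen_ne.mem_nhds hz
  have hb : IntegrableOn logKernelBound (Ioc 0 (‖z‖ + 1)) := by
    rw [← intervalIntegrable_iff_integrableOn_Ioc_of_le (by positivity)]
    exact intervalIntegrable_logKernelBound _ _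
  refine (continuousAt_of_dominated (bound := logKernelBound) ?_ ?_ hb ?_).neg
  · exact Eventually.of_forall fun w =>
      ((measurable_logKernel _).indicator measurableSet_Ioc).aestronglyMeasurable
  · filter_upwards [hne] with w hw
    filter_upwards [ae_restrict_of_ae (Measure.ae_ne volume 1),
      ae_restrict_mem measurableSet_Ioc] with τ h1 h2
    refine (norm_indicator_le_norm_self _ _).trans ?_
    exact abs_logKernel_le_of_norm_eq_one (norm_div_norm_self hw) h2.1 h1
  · filter_upwards [ae_restrict_of_ae (Measure.ae_ne volume 1),
      ae_restrict_of_ae (Measure.ae_ne volume ‖z‖), ae_restrict_mem measurableSet_Ioc]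
      with τ h1 h2 h3
    rcases lt_or_gt_of_ne h2 with h | h
    · have hc : ContinuousAt (fun w : ℂ => logKernel (w / ‖w‖) τ) z := by
        have hz' : (‖z‖ : ℂ) ≠ 0 := by exact_mod_cast norm_ne_zero_iff.mpr hz
        have h4 : ‖1 - (τ : ℂ) * (z / ‖z‖)‖ ≠ 0 := by
          rw [norm_ne_zero_iff, sub_ne_zero]
          intro h5
          have := congrArg norm h5
          rw [norm_mul, norm_div_norm_self hz, norm_one, mul_one, Complex.norm_real,
            Real.norm_eq_abs, abs_of_pos h3.1] at this
          exact h1 this.symm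
        unfold logKernel
        have h6 : ContinuousAt (fun w : ℂ => (‖w‖ : ℂ)) z := by fun_prop
        have h7 : ContinuousAt (fun w : ℂ => w / (‖w‖ : ℂ)) z := continuousAt_id.div h6 hz'
        have h8 : ContinuousAt (fun w : ℂ => ‖1 - (τ : ℂ) * (w / ‖w‖)‖) z := by fun_prop
        exact (h8.log h4).div_const _
      refine hc.congr ?_
      filter_upwards [continuousAt_const.eventually_lt continuous_norm.continuousAt h] with w hw
      rw [indicator_of_mem (show τ ∈ Ioc 0 ‖w‖ from ⟨h3.1, hw.le⟩)]
    · refine (continuousAt_const (y := (0 : ℝ))).congr ?_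
      filter_upwards [continuous_norm.continuousAt.eventually_lt continuousAt_const h] with w hw
      rw [indicator_of_notMem fun h' => hw.not_ge h'.2]

lemma hasDerivAt_re_dilog_ofReal_mul {u : ℂ} {r : ℝ} (hr : 0 < r)
    (h : 1 - (r : ℂ) * u ≠ 0) :
    HasDerivAt (fun r : ℝ => (dilog (r * u)).re) (-logKernel u r) r := by
  simp only [re_dilog_ofReal_mul]
  refine (integral_hasDerivAt_right (intervalIntegrable_logKernel u le_rfl hr.le)
    (measurable_logKernel u).stronglyMeasurable.stronglyMeasurableAtFilter ?_).neg
  have h1 : ContinuousAt (fun r : ℝ => ‖1 - (r : ℂ) * u‖) r := by fun_prop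
  exact (h1.log (norm_ne_zero_iff.mpr h)).div continuousAt_id hr.ne'

lemma one_sub_ofReal_mul_ne_zero {u : ℂ} (hu : ‖u‖ = 1) {r : ℝ} (h0 : 0 < r) (h1 : r ≠ 1) :
    1 - (r : ℂ) * u ≠ 0 := by
  rw [sub_ne_zero]
  intro h
  have := congrArg norm h
  rw [norm_mul, hu, norm_one, mul_one, Complex.norm_real, Real.norm_eq_abs, abs_of_pos h0] at this
  exact h1 this.symm

lemma continuous_re_dilog_ofReal_mul (u : ℂ) : Continuous fun r : ℝ => (dilog (r * u)).re :=
  continuous_re_dilog.comp (by fun_prop)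

lemma norm_one_sub_inv_mul {u : ℂ} (hu : ‖u‖ = 1) {r : ℝ} (hr : 0 < r) :
    ‖1 - ((r⁻¹ : ℝ) : ℂ) * u‖ = ‖1 - (r : ℂ) * u‖ / r := by
  have hu' : u.re * u.re + u.im * u.im = 1 := by
    rw [← Complex.normSq_apply, Complex.normSq_eq_norm_sq, hu, one_pow]
  rw [eq_div_iff hr.ne', ← sq_eq_sq₀ (by positivity) (by positivity), mul_pow,
    ← Complex.normSq_eq_norm_sq, ← Complex.normSq_eq_norm_sq, Complex.normSq_apply,
    Complex.normSq_apply]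
  simp only [Complex.sub_re, Complex.sub_im, Complex.re_ofReal_mul, Complex.im_ofReal_mul,
    Complex.one_re, Complex.one_im]
  field_simp
  linear_combination (1 - r ^ 2) * hu'

lemma eq_of_hasDerivAt_zero {f : ℝ → ℝ} {a b : ℝ} (hab : a ≤ b) (hf : ContinuousOn f (Icc a b))
    (hd : ∀ x ∈ Ioo a b, HasDerivAt f 0 x) : f b = f a := by
  rcases hab.eq_or_lt with rfl | hab
  · rfl
  obtain ⟨c, -, hc⟩ := exists_hasDerivAt_eq_slope f (fun _ => 0) hab hf hd
  rw [eq_div_iff (sub_pos.mpr hab).ne', zero_mul] at hc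
  linarith

/-- The real part of the inversion formula for the dilogarithm, on rays. -/
lemma re_dilog_inversion {u : ℂ} (hu : ‖u‖ = 1) {r : ℝ} (hr : 1 ≤ r) :
    (dilog (r * u)).re + (dilog ((r⁻¹ : ℝ) * u)).re =
      2 * (dilog u).re - Real.log r ^ 2 / 2 := by
  have hc := continuous_re_dilog_ofReal_mul u
  have key := eq_of_hasDerivAt_zero
    (f := fun x : ℝ => (dilog (x * u)).re + (dilog ((x⁻¹ : ℝ) * u)).re + Real.log x ^ 2 / 2)
    hr ?_ ?_
  · simp at key
    simp
    linarith
  · have h1 : ContinuousOn (fun x : ℝ => x⁻¹) (Icc 1 r) :=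
      continuousOn_inv₀.mono fun x hx => (zero_lt_one.trans_le hx.1).ne'
    have h2 : ContinuousOn Real.log (Icc 1 r) :=
      Real.continuousOn_log.mono fun x hx => (zero_lt_one.trans_le hx.1).ne'
    exact (hc.continuousOn.add (hc.comp_continuousOn h1)).add ((h2.pow 2).div_const 2)
  · intro x hx
    have hx0 : 0 < x := zero_lt_one.trans hx.1
    have hne := one_sub_ofReal_mul_ne_zero hu hx0 hx.1.ne'
    have hne' := one_sub_ofReal_mul_ne_zero hu (inv_pos.mpr hx0) (inv_lt_one_of_one_lt₀ hx.1).ne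
    have h1 := hasDerivAt_re_dilog_ofReal_mul hx0 hne
    have h2 := (hasDerivAt_re_dilog_ofReal_mul (inv_pos.mpr hx0) hne').comp x
      (hasDerivAt_inv hx0.ne')
    have h3 := ((Real.hasDerivAt_log hx0.ne').pow 2).div_const 2
    refine ((h1.add h2).add h3).congr_deriv ?_
    rw [logKernel, logKernel, norm_one_sub_inv_mul hu hx0,
      Real.log_div (norm_ne_zero_iff.mpr hne) hx0.ne']
    simp only [Nat.cast_ofNat]
    field_simp
    ring

lemma re_dilog_duplication : (dilog 1).re + (dilog (-1)).re = (dilog 1).re / 2 := by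
  have hc := continuous_re_dilog_ofReal_mul 1
  have hc' := continuous_re_dilog_ofReal_mul (-1)
  have key := eq_of_hasDerivAt_zero (a := 0) (b := 1)
    (f := fun x : ℝ => (dilog (x * 1)).re + (dilog (x * (-1))).re -
      (dilog ((x ^ 2 : ℝ) * 1)).re / 2) zero_le_one ?_ ?_
  · have h0 : (dilog 0).re = 0 := by simp [re_dilog_polar]
    simp [h0] at key
    linarith
  · exact ((hc.add hc').sub
      ((hc.comp (continuous_pow 2)).div_const 2)).continuousOn
  · intro x hx
    have hx2 : x ^ 2 < 1 := by nlinarith [hx.1, hx.2]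
    have hne := one_sub_ofReal_mul_ne_zero (u := 1) (by simp) hx.1 hx.2.ne
    have hne' := one_sub_ofReal_mul_ne_zero (u := -1) (by simp) hx.1 hx.2.ne
    have hne'' := one_sub_ofReal_mul_ne_zero (u := 1) (by simp) (pow_pos hx.1 2) hx2.ne
    have h1 := hasDerivAt_re_dilog_ofReal_mul hx.1 hne
    have h2 := hasDerivAt_re_dilog_ofReal_mul hx.1 hne'
    have h3 := ((hasDerivAt_re_dilog_ofReal_mul (pow_pos hx.1 2) hne'').comp (h := fun x : ℝ => x ^ 2) x
      (hasDerivAt_pow 2 x)).div_const 2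
    refine ((h1.add h2).sub h3).congr_deriv ?_
    have hf : ‖1 - ((x ^ 2 : ℝ) : ℂ) * 1‖ =
        ‖1 - (x : ℂ) * 1‖ * ‖1 - (x : ℂ) * (-1)‖ := by
      rw [← norm_mul]
      congr 1
      push_cast
      ring
    have hx0 := hx.1.ne'
    rw [logKernel, logKernel, logKernel, hf,
      Real.log_mul (norm_ne_zero_iff.mpr hne) (norm_ne_zero_iff.mpr hne')]
    simp only [Nat.cast_ofNat]
    field_simp
    ring

lemma re_dilog_one : (dilog 1).re = Real.pi ^ 2 / 6 := by
  have hint : ∀ n : ℕ, ∫ t in Ioc (0 : ℝ) 1, t ^ n / ((n : ℝ) + 1) = 1 / ((n : ℝ) + 1) ^ 2 := by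
    intro n
    rw [← integral_of_le zero_le_one, intervalIntegral.integral_div, integral_pow]
    simp
    field_simp
  have hz : HasSum (fun n : ℕ => 1 / ((n : ℝ) + 1) ^ 2) (Real.pi ^ 2 / 6) := by
    have := (hasSum_nat_add_iff' 1).mpr hasSum_zeta_two
    simpa using this
  have hsum := hasSum_integral_of_summable_integral_norm
    (F := fun (n : ℕ) (t : ℝ) => t ^ n / ((n : ℝ) + 1)) (μ := volume.restrict (Ioc (0 : ℝ) 1))
    (fun n => by
      change IntegrableOn (fun t : ℝ => t ^ n / ((n : ℝ) + 1)) (Ioc 0 1) volume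
      rw [← intervalIntegrable_iff_integrableOn_Ioc_of_le zero_le_one]
      exact Continuous.intervalIntegrable (by fun_prop) _ _)
    (by
      refine hz.summable.congr fun n => ?_
      rw [← hint n]
      refine setIntegral_congr_fun measurableSet_Ioc fun t ht => ?_
      have := ht.1
      simp only [Real.norm_eq_abs]
      rw [abs_of_nonneg (by positivity)])
  simp only [hint] at hsum
  rw [hz.unique hsum, re_dilog, integral_of_le zero_le_one, ← MeasureTheory.integral_neg]
  refine integral_congr_ae ?_
  filter_upwards [ae_restrict_of_ae (Measure.ae_ne volume 1), ae_restrict_mem measurableSet_Ioc]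
    with t h1 h2
  have ht : |t| < 1 := by
    rw [abs_of_pos h2.1]
    exact lt_of_le_of_ne h2.2 h1
  have h3 := (Real.hasSum_pow_div_log_of_abs_lt_one ht).div_const t
  have h4 : ‖1 - (t : ℂ) * 1‖ = 1 - t := by
    rw [mul_one, ← Complex.ofReal_one, ← Complex.ofReal_sub, Complex.norm_real, Real.norm_eq_abs,
      abs_of_pos]
    linarith [le_abs_self t]
  have ht0 := h2.1.ne'
  rw [logKernel, h4, ← neg_div, ← h3.tsum_eq]
  refine tsum_congr fun n => ?_
  field_simp
  ring

lemma re_dilog_neg_one : (dilog (-1)).re = -(Real.pi ^ 2 / 12) := by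
  linarith [re_dilog_duplication, re_dilog_one]

lemma dilog_neg_one : dilog (-1) = ((-(Real.pi ^ 2 / 12) : ℝ) : ℂ) := by
  apply Complex.ext
  · rw [re_dilog_neg_one, Complex.ofReal_re]
  · rw [im_dilog, Complex.ofReal_im, neg_eq_zero]
    refine (integral_congr (g := fun _ => (0 : ℝ)) fun t ht => ?_).trans (by simp)
    rw [uIcc_of_le zero_le_one] at ht
    have : (1 - (t : ℂ) * -1) = ((1 + t : ℝ) : ℂ) := by push_cast; ring
    simp only [this]
    rw [Complex.arg_ofReal_of_nonneg (by linarith [ht.1]), zero_div]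

lemma norm_dilog_sub_dilog_neg_one_le {w : ℂ} (hw : ‖w‖ ≤ 1 / 2) :
    ‖dilog (-1 - w) - dilog (-1)‖ ≤ 3 / 2 * ‖w‖ := by
  rw [dilog, dilog, ← neg_sub', norm_neg,
    ← integral_sub (intervalIntegrable_dilog_integrand _) (intervalIntegrable_dilog_integrand _)]
  have := intervalIntegral.norm_integral_le_of_norm_le_const (a := 0) (b := 1)
    (f := fun t : ℝ => Complex.log (1 - (t : ℂ) * (-1 - w)) / (t : ℂ) -
      Complex.log (1 - (t : ℂ) * -1) / (t : ℂ)) (C := 3 / 2 * ‖w‖) (fun t ht => by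
      rw [uIoc_of_le zero_le_one] at ht
      have ht0 := ht.1
      have h1 : (0 : ℝ) < 1 + t := by linarith
      have h1' : (1 + t : ℂ) ≠ 0 := by exact_mod_cast h1.ne'
      have h2 : ‖(t : ℂ) * w / (1 + t)‖ ≤ t * ‖w‖ := by
        rw [norm_div, norm_mul, Complex.norm_real, Real.norm_eq_abs, abs_of_pos ht0,
          show (1 + t : ℂ) = ((1 + t : ℝ) : ℂ) by push_cast; rfl, Complex.norm_real,
          Real.norm_eq_abs, abs_of_pos h1]
        exact div_le_self (by positivity) (by linarith)
      have h2' : ‖(t : ℂ) * w / (1 + t)‖ ≤ 1 / 2 := by nlinarith [ht.2, norm_nonneg w]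
      have h3 : 1 + (t : ℂ) * w / (1 + t) ≠ 0 := by
        intro h
        have h' := eq_neg_of_add_eq_zero_right h
        rw [h'] at h2'
        norm_num at h2'
      have h4 : 1 - (t : ℂ) * (-1 - w) = ((1 + t : ℝ) : ℂ) * (1 + (t : ℂ) * w / (1 + t)) := by
        push_cast
        field_simp
        ring
      have h5 : 1 - (t : ℂ) * -1 = ((1 + t : ℝ) : ℂ) := by push_cast; ring
      rw [h4, Complex.log_ofReal_mul h1 h3, h5, ← Complex.ofReal_log h1.le, ← sub_div,
        add_sub_cancel_left, norm_div, Complex.norm_real, Real.norm_eq_abs, abs_of_pos ht0,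
        div_le_iff₀ ht0]
      have := Complex.norm_log_one_add_half_le_self h2'
      nlinarith)
  simpa using this

lemma log_sub_log_le {a b : ℝ} (ha : 0 < a) (hb : 0 < b) :
    Real.log a - Real.log b ≤ (a - b) / b := by
  rw [← Real.log_div ha.ne' hb.ne', sub_div, div_self hb.ne']
  exact Real.log_le_sub_one_of_pos (div_pos ha hb)

lemma log_sq_sub_log_sq_le {a b : ℝ} (ha : 1 ≤ a) (hab : |b - a| ≤ 1) (hb : 1 ≤ b) :
    Real.log b ^ 2 - Real.log a ^ 2 ≤ 2 := by
  have h1 := Real.log_nonneg ha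
  have h2 := Real.log_nonneg hb
  have ha0 : 0 < a := by linarith
  have hb0 : 0 < b := by linarith
  have hab' := abs_le.mp hab
  rcases le_total b a with h | h
  · have := Real.log_le_log hb0 h
    nlinarith
  · have h3 := Real.log_le_log ha0 h
    have h4 := log_sub_log_le hb0 ha0
    rw [le_div_iff₀ ha0] at h4
    have h5 := Real.log_le_sub_one_of_pos hb0
    nlinarith

lemma log_sq_le {r : ℝ} (hr : 1 ≤ r) : Real.log r ^ 2 ≤ 4 * r := by
  have h0 : 0 < √r := Real.sqrt_pos.mpr (by linarith)
  have h1 := Real.log_le_sub_one_of_pos h0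
  rw [Real.log_sqrt (by linarith)] at h1
  have h2 := Real.log_nonneg hr
  nlinarith [Real.sq_sqrt (show 0 ≤ r by linarith)]

lemma exists_abs_re_dilog_le :
    ∃ C, 0 ≤ C ∧ (∀ z, ‖z‖ ≤ 1 → |(dilog z).re| ≤ C) ∧
      ∀ z, 1 ≤ ‖z‖ → |(dilog z).re + Real.log ‖z‖ ^ 2 / 2| ≤ C := by
  obtain ⟨C, hC⟩ := (isCompact_closedBall (0 : ℂ) 1).exists_bound_of_continuousOn
    continuous_re_dilog.continuousOn
  replace hC : ∀ z : ℂ, ‖z‖ ≤ 1 → |(dilog z).re| ≤ C := fun z hz => hC z (by simpa using hz)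
  have hC0 : 0 ≤ C := (abs_nonneg _).trans (hC 0 (by simp))
  refine ⟨3 * C, by linarith, fun z hz => (hC z hz).trans (by linarith), fun z hz => ?_⟩
  have hz0 : z ≠ 0 := norm_pos_iff.mp (by linarith)
  have hu := norm_div_norm_self hz0
  have h := re_dilog_inversion hu hz
  rw [mul_div_cancel₀ _ (show (‖z‖ : ℂ) ≠ 0 by exact_mod_cast norm_ne_zero_iff.mpr hz0)] at h
  have h1 := abs_le.mp (hC _ hu.le)
  have h2 := abs_le.mp (hC (((‖z‖⁻¹ : ℝ) : ℂ) * (z / ‖z‖)) (by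
    rw [norm_mul, hu, mul_one, Complex.norm_real, norm_inv, norm_norm]
    exact inv_le_one_of_one_le₀ hz))
  rw [abs_le]
  constructor <;> linarith [h1.1, h1.2, h2.1, h2.2]

lemma re_phi1 (z : ℂ) : (phi1 z).re =
    (z.re * (dilog (z / (1 - z))).re - z.im * (dilog (z / (1 - z))).im -
      (dilog (1 / (z - 1))).re) / Real.pi + Real.pi / 12 * z.re + Real.log 2 / Real.pi := by
  rw [phi1, ← Complex.ofReal_inv]
  simp only [Complex.add_re, Complex.re_ofReal_mul, Complex.sub_re, Complex.mul_re z,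
    Complex.ofReal_re]
  ring

lemma div_one_sub_eq {z : ℂ} (hz : z ≠ 1) : z / (1 - z) = -1 - 1 / (z - 1) := by
  have h1 : z - 1 ≠ 0 := sub_ne_zero.mpr hz
  have h2 : 1 - z ≠ 0 := sub_ne_zero.mpr hz.symm
  field_simp
  ring

lemma continuousOn_re_phi1 : ContinuousOn (fun z => (phi1 z).re) {(1 : ℂ)}ᶜ := by
  intro z hz
  refine ContinuousAt.continuousWithinAt ?_
  have h1 : z - 1 ≠ 0 := sub_ne_zero.mpr hz
  have h2 : 1 - z ≠ 0 := sub_ne_zero.mpr (Ne.symm hz)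
  have hu : ContinuousAt (fun z : ℂ => z / (1 - z)) z :=
    continuousAt_id.div (by fun_prop) h2
  have hv : ContinuousAt (fun z : ℂ => 1 / (z - 1)) z :=
    continuousAt_const.div (by fun_prop) h1
  have hRu : ContinuousAt (fun z : ℂ => (dilog (z / (1 - z))).re) z :=
    continuous_re_dilog.continuousAt.comp hu
  have hRv : ContinuousAt (fun z : ℂ => (dilog (1 / (z - 1))).re) z :=
    continuous_re_dilog.continuousAt.comp hv
  have hI : ContinuousAt (fun z : ℂ => z.im * (dilog (z / (1 - z))).im) z := by
    by_cases him : z.im = 0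
    · have hb : ContinuousAt (fun z : ℂ => |z.im| * (2 * Real.pi * ‖z / (1 - z)‖)) z := by
        fun_prop (disch := assumption)
      have hb0 := hb.tendsto
      simp only [him, abs_zero, zero_mul] at hb0
      rw [ContinuousAt, him, zero_mul]
      refine squeeze_zero_norm (fun w => ?_) hb0
      rw [Real.norm_eq_abs, abs_mul]
      exact mul_le_mul_of_nonneg_left (abs_im_dilog_le _) (abs_nonneg _)
    · have him' : (z / (1 - z)).im ≠ 0 := by
        have : (z / (1 - z)).im = z.im / Complex.normSq (1 - z) := by
          rw [Complex.div_im]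
          simp
          ring
        rw [this]
        exact div_ne_zero him (Complex.normSq_pos.mpr h2).ne'
      exact Complex.continuous_im.continuousAt.mul
        (ContinuousAt.comp (f := fun z : ℂ => z / (1 - z)) (continuousAt_im_dilog him') hu)
  simp only [re_phi1]
  have hre : ContinuousAt Complex.re z := Complex.continuous_re.continuousAt
  exact ((((hre.mul hRu).sub hI).sub hRv).div_const _ |>.add (hre.const_mul _)).add_const _

lemma exists_abs_re_phi1_le_near_one :
    ∃ M : ℝ, ∀ z : ℂ, z ≠ 1 → ‖z - 1‖ ≤ 1 / 4 → |(phi1 z).re| ≤ M := by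
  obtain ⟨C, hC0, -, hC⟩ := exists_abs_re_dilog_le
  refine ⟨(2 * C + 1 + (C + 4) + 4 * Real.pi) / Real.pi + Real.pi / 12 * 2 +
    Real.log 2 / Real.pi, fun z hz hz' => ?_⟩
  have hpi := Real.pi_pos
  have h1 : z - 1 ≠ 0 := sub_ne_zero.mpr hz
  have hs : 0 < ‖z - 1‖ := norm_pos_iff.mpr h1
  have hzn : ‖z‖ ≤ 2 := by
    have := norm_le_norm_add_norm_sub' z 1
    rw [norm_one] at this
    linarith
  have huv := div_one_sub_eq hz
  have hsu : ‖z - 1‖ * ‖z / (1 - z)‖ = ‖z‖ := by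
    rw [norm_div, norm_sub_rev 1 z, mul_div_cancel₀ _ hs.ne']
  have hsv : ‖z - 1‖ * ‖1 / (z - 1)‖ = 1 := by
    rw [norm_div, norm_one, mul_one_div_cancel hs.ne']
  rw [re_phi1]
  set u := z / (1 - z)
  set v := 1 / (z - 1)
  have hv : 4 ≤ ‖v‖ := by nlinarith [norm_nonneg v]
  have huv' : |‖u‖ - ‖v‖| ≤ 1 := by
    have := abs_norm_sub_norm_le u (-v)
    rw [norm_neg, huv, sub_neg_eq_add, sub_add_cancel, norm_neg, norm_one, ← huv] at this
    exact this
  have hu : 3 ≤ ‖u‖ := by linarith [(abs_le.mp huv').1]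
  have hRu := hC u (by linarith)
  have hRv := hC v (by linarith)
  have hl1 := log_sq_sub_log_sq_le (a := ‖v‖) (b := ‖u‖) (by linarith) huv' (by linarith)
  have hl2 := log_sq_sub_log_sq_le (a := ‖u‖) (b := ‖v‖) (by linarith)
    (by rwa [abs_sub_comm]) (by linarith)
  have hD : |(dilog u).re - (dilog v).re| ≤ 2 * C + 1 := by
    rw [abs_le] at hRu hRv ⊢
    constructor <;> linarith [hRu.1, hRu.2, hRv.1, hRv.2]
  have hsR : |(z.re - 1) * (dilog u).re| ≤ C + 4 := by
    have h2 : |z.re - 1| ≤ ‖z - 1‖ := by simpa using Complex.abs_re_le_norm (z - 1)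
    have h3 : |(dilog u).re| ≤ C + 2 * ‖u‖ := by
      have := log_sq_le (r := ‖u‖) (by linarith)
      rw [abs_le] at hRu ⊢
      constructor <;> nlinarith [hRu.1, hRu.2, sq_nonneg (Real.log ‖u‖)]
    rw [abs_mul]
    calc _ ≤ ‖z - 1‖ * (C + 2 * ‖u‖) := by gcongr
      _ ≤ C + 4 := by nlinarith
  have hsI : |z.im * (dilog u).im| ≤ 4 * Real.pi := by
    have h2 : |z.im| ≤ ‖z - 1‖ := by simpa using Complex.abs_im_le_norm (z - 1)
    rw [abs_mul]
    calc _ ≤ ‖z - 1‖ * (2 * Real.pi * ‖u‖) := by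
          gcongr
          exact abs_im_dilog_le u
      _ = 2 * Real.pi * (‖z - 1‖ * ‖u‖) := by ring
      _ ≤ 2 * Real.pi * 2 := by rw [hsu]; gcongr
      _ = _ := by ring
  have hzr : |z.re| ≤ 2 := (Complex.abs_re_le_norm z).trans hzn
  have hlog : 0 ≤ Real.log 2 / Real.pi := by positivity
  have hnum : |z.re * (dilog u).re - z.im * (dilog u).im - (dilog v).re| ≤
      2 * C + 1 + (C + 4) + 4 * Real.pi := by
    rw [abs_le] at hD hsR hsI ⊢
    constructor <;> linarith [hD.1, hD.2, hsR.1, hsR.2, hsI.1, hsI.2]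
  refine (abs_add_three _ _ _).trans ?_
  rw [abs_div, abs_of_pos hpi, abs_of_nonneg hlog, abs_mul,
    abs_of_pos (show 0 < Real.pi / 12 by positivity)]
  gcongr

lemma phi1_eq (z : ℂ) : phi1 z =
    (Real.pi : ℂ)⁻¹ * (z * (dilog (z / (1 - z)) - dilog (-1)) - dilog (1 / (z - 1))) +
      (Real.pi : ℂ)⁻¹ * (Real.log 2 : ℝ) := by
  have : (Real.pi : ℂ) ≠ 0 := by exact_mod_cast Real.pi_ne_zero
  rw [phi1, dilog_neg_one]
  push_cast
  field_simp
  ring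

lemma exists_abs_re_phi1_le_near_infty :
    ∃ M : ℝ, ∀ z : ℂ, 4 ≤ ‖z - 1‖ → |(phi1 z).re| ≤ M := by
  obtain ⟨C, -, hC, -⟩ := exists_abs_re_dilog_le
  refine ⟨Real.pi⁻¹ * (3 + C) + Real.pi⁻¹ * Real.log 2, fun z hz => ?_⟩
  have hpi := Real.pi_pos
  have hs : 0 < ‖z - 1‖ := by linarith
  have hz1 : z ≠ 1 := sub_ne_zero.mp (norm_pos_iff.mp hs)
  have hsv : ‖z - 1‖ * ‖1 / (z - 1)‖ = 1 := by
    rw [norm_div, norm_one, mul_one_div_cancel hs.ne']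
  rw [phi1_eq, div_one_sub_eq hz1, ← Complex.ofReal_inv, Complex.add_re, Complex.re_ofReal_mul,
    Complex.re_ofReal_mul, Complex.ofReal_re, Complex.sub_re]
  set v := 1 / (z - 1)
  have hv : ‖v‖ ≤ 1 / 4 := by nlinarith [norm_nonneg v]
  have hzn : ‖z‖ ≤ ‖z - 1‖ + 1 := by
    have := norm_le_norm_add_norm_sub' z 1
    rw [norm_one] at this
    linarith
  have h1 : |(z * (dilog (-1 - v) - dilog (-1))).re| ≤ 3 := by
    refine (Complex.abs_re_le_norm _).trans ?_
    rw [norm_mul]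
    calc _ ≤ (‖z - 1‖ + 1) * (3 / 2 * ‖v‖) := by
          gcongr
          exact norm_dilog_sub_dilog_neg_one_le (by linarith)
      _ ≤ 3 := by nlinarith
  have h2 := hC v (by linarith)
  refine (abs_add_le _ _).trans ?_
  rw [abs_mul, abs_of_pos (inv_pos.mpr hpi),
    abs_of_nonneg (by positivity : 0 ≤ Real.pi⁻¹ * Real.log 2)]
  gcongr
  exact (abs_sub _ _).trans (add_le_add h1 h2)

lemma exists_abs_re_phi1_le : ∃ M : ℝ, ∀ z : ℂ, z ≠ 1 → |(phi1 z).re| ≤ M := by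
  obtain ⟨M₁, h₁⟩ := exists_abs_re_phi1_le_near_one
  obtain ⟨M₂, h₂⟩ := exists_abs_re_phi1_le_near_infty
  obtain ⟨M₃, h₃⟩ := ((isCompact_closedBall (1 : ℂ) 4).diff
    (Metric.isOpen_ball (x := (1 : ℂ)) (ε := 1 / 4))).exists_bound_of_continuousOn
    (continuousOn_re_phi1.mono fun z hz h => hz.2 (by
      rw [mem_singleton_iff.mp h]
      exact Metric.mem_ball_self (by norm_num)))
  refine ⟨max M₁ (max M₂ M₃), fun z hz => ?_⟩
  rcases le_or_gt ‖z - 1‖ (1 / 4) with h | h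
  · exact (h₁ z hz h).trans (le_max_left _ _)
  rcases le_or_gt 4 ‖z - 1‖ with h' | h'
  · exact (h₂ z h').trans ((le_max_left _ _).trans (le_max_right _ _))
  · refine (h₃ z ⟨?_, ?_⟩).trans ((le_max_right _ _).trans (le_max_right _ _))
    · rw [mem_closedBall_iff_norm]
      exact h'.le
    · rw [mem_ball_iff_norm]
      exact h.le.not_gt

lemma tendsto_re_dilog_add_log_sq {u : ℂ} (hu : ‖u‖ = 1) :
    Tendsto (fun r : ℝ => (dilog (r * u)).re + Real.log r ^ 2 / 2) atTop
      (𝓝 (2 * (dilog u).re)) := by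
  have h0 : (dilog 0).re = 0 := by simp [re_dilog_polar]
  have h := ((continuous_re_dilog_ofReal_mul u).tendsto 0).comp tendsto_inv_atTop_zero
  simp only [Complex.ofReal_zero, zero_mul, h0] at h
  have h' := h.const_sub (2 * (dilog u).re)
  rw [sub_zero] at h'
  refine h'.congr' ?_
  filter_upwards [eventually_ge_atTop 1] with r hr
  have := re_dilog_inversion hu hr
  simp only [Function.comp_apply]
  linarith

lemma tendsto_log_pow_div_atTop (n : ℕ) :
    Tendsto (fun r : ℝ => Real.log r ^ n / r) atTop (𝓝 0) :=
  Real.isLittleO_pow_log_id_atTop.tendsto_div_nhds_zero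

lemma tendsto_re_dilog_div {u : ℂ} (hu : ‖u‖ = 1) :
    Tendsto (fun r : ℝ => (dilog (r * u)).re / r) atTop (𝓝 0) := by
  have h1 := (tendsto_re_dilog_add_log_sq hu).mul tendsto_inv_atTop_zero
  have h2 := h1.sub ((tendsto_log_pow_div_atTop 2).div_const 2)
  rw [mul_zero, zero_div, sub_zero] at h2
  refine h2.congr fun r => ?_
  ring

lemma tendsto_log_sq_sub_log_sq {e : ℝ} (he : |e| = 1) :
    Tendsto (fun r : ℝ => Real.log r ^ 2 - Real.log (r + e) ^ 2) atTop (𝓝 0) := by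
  have h := (tendsto_log_pow_div_atTop 1).const_mul 8
  rw [mul_zero] at h
  refine squeeze_zero_norm' ?_ h
  filter_upwards [eventually_ge_atTop 2] with r hr
  have he' := abs_le.mp he.le
  have hr0 : 0 < r := by linarith
  have hre : 0 < r + e := by linarith
  have h1 := log_sub_log_le hre hr0
  have h2 := log_sub_log_le hr0 hre
  rw [le_div_iff₀ hr0] at h1
  rw [le_div_iff₀ hre] at h2
  have h3 : 0 ≤ Real.log (r + e) := Real.log_nonneg (by linarith)
  have h4 : Real.log 2 ≤ Real.log r := Real.log_le_log two_pos hr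
  have h5 : Real.log (r + e) ≤ Real.log 2 + Real.log r := by
    rw [← Real.log_mul two_ne_zero hr0.ne']
    exact Real.log_le_log hre (by linarith)
  have h6 : 0 ≤ Real.log r := Real.log_nonneg (by linarith)
  have h7 : |Real.log r - Real.log (r + e)| * r ≤ 2 := by
    rw [← le_div_iff₀ hr0, abs_le, ← neg_div, div_le_iff₀ hr0, le_div_iff₀ hr0]
    constructor
    · linarith
    · by_contra! h
      nlinarith
  have h8 : |Real.log r + Real.log (r + e)| ≤ 4 * Real.log r := by
    rw [abs_of_nonneg (by linarith)]
    linarith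
  rw [pow_one, mul_div_assoc', le_div_iff₀ hr0, Real.norm_eq_abs, sq_sub_sq, abs_mul]
  calc _ = |Real.log r + Real.log (r + e)| * (|Real.log r - Real.log (r + e)| * r) := by ring
    _ ≤ 4 * Real.log r * 2 := by gcongr
    _ = _ := by ring

/-- The behaviour of `Re φ₁` at `1` along the real axis, in the coordinate `r = |x - 1|⁻¹`. -/
lemma tendsto_re_phi1_one_add {e : ℝ} (he : e = 1 ∨ e = -1) :
    Tendsto (fun r : ℝ => (phi1 ((1 + e * r⁻¹ : ℝ) : ℂ)).re) atTop
      (𝓝 (Real.log 2 / Real.pi + Real.pi / 12 - e * (Real.pi / 2))) := by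
  have habs : |e| = 1 := by rcases he with rfl | rfl <;> simp
  have hee : e * e = 1 := by rcases he with rfl | rfl <;> simp
  have hshift : Tendsto (fun r : ℝ => r + e) atTop atTop :=
    tendsto_atTop_add_const_right _ _ tendsto_id
  have hn : ‖(e : ℂ)‖ = 1 := by rw [Complex.norm_real, Real.norm_eq_abs, habs]
  have hn' : ‖(-e : ℂ)‖ = 1 := by rw [norm_neg, hn]
  have h1 := (tendsto_re_dilog_add_log_sq hn').comp hshift
  have h2 := tendsto_re_dilog_add_log_sq hn
  have h3 := (tendsto_log_sq_sub_log_sq habs).div_const 2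
  have hinv : Tendsto (fun r : ℝ => 1 + e * r⁻¹) atTop (𝓝 1) := by
    simpa using (tendsto_inv_atTop_zero.const_mul e).const_add 1
  have h4 := (((tendsto_re_dilog_div hn').comp hshift).mul hinv).const_mul e
  have h5 := ((((h1.sub h2).add h3).add h4).div_const Real.pi).add
    (hinv.const_mul (Real.pi / 12)) |>.add_const (Real.log 2 / Real.pi)
  have hlim : (2 * (dilog (-e)).re - 2 * (dilog e).re + 0 / 2 + e * (0 * 1)) / Real.pi +
      Real.pi / 12 * 1 + Real.log 2 / Real.pi =
      Real.log 2 / Real.pi + Real.pi / 12 - e * (Real.pi / 2) := by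
    have := Real.pi_ne_zero
    rcases he with rfl | rfl <;>
      simp only [Complex.ofReal_neg, Complex.ofReal_one, neg_neg, re_dilog_one,
        re_dilog_neg_one] <;> field_simp <;> ring
  rw [hlim] at h5
  refine h5.congr' ?_
  filter_upwards [eventually_ge_atTop 2] with r hr
  have hr0 : r ≠ 0 := by linarith
  have he0 : e ≠ 0 := by rintro rfl; simp at hee
  have hre : r + e ≠ 0 := by linarith [(abs_le.mp habs.le).1]
  have hu : ((1 + e * r⁻¹ : ℝ) : ℂ) / (1 - ((1 + e * r⁻¹ : ℝ) : ℂ)) =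
      ((r + e : ℝ) : ℂ) * (-e) := by
    norm_cast
    rw [div_eq_iff (by simp [he0, hr0])]
    field_simp
    linear_combination -hee
  have hv : 1 / (((1 + e * r⁻¹ : ℝ) : ℂ) - 1) = (r : ℂ) * e := by
    norm_cast
    rw [div_eq_iff (by simp [he0, hr0])]
    field_simp
    linear_combination -hee
  rw [re_phi1, hu, hv, Complex.ofReal_re, Complex.ofReal_im]
  simp only [Function.comp_apply]
  field_simp
  ring

end

/-- `Re φ₁` is bounded on `ℂ∖[1/2,2]` and extends to a bounded continuous
function on `ℂ∖{1}`, whose one-sided limits along `ℝ` at `1` are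
`(1/π)·log 2 + π/12 ∓ π/2` (Corollary 5.3). -/
theorem re_phi1_bounded_and_jump_at_one :
    (∃ M : ℝ, ∀ z ∈ cutPlane (1 / 2) 2, |(phi1 z).re| ≤ M) ∧
      ∃ F : ℂ → ℝ, ContinuousOn F {(1 : ℂ)}ᶜ ∧
        (∃ M : ℝ, ∀ z : ℂ, z ≠ 1 → |F z| ≤ M) ∧
        (∀ z ∈ cutPlane (1 / 2) 2, F z = (phi1 z).re) ∧
        Tendsto (fun x : ℝ => F (x : ℂ)) (nhdsWithin 1 (Set.Ioi 1))
          (nhds (Real.log 2 / Real.pi + Real.pi / 12 - Real.pi / 2)) ∧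
        Tendsto (fun x : ℝ => F (x : ℂ)) (nhdsWithin 1 (Set.Iio 1))
          (nhds (Real.log 2 / Real.pi + Real.pi / 12 + Real.pi / 2)) := by
  obtain ⟨M, hM⟩ := exists_abs_re_phi1_le
  have hne : ∀ z ∈ cutPlane (1 / 2) 2, z ≠ 1 := by
    rintro z hz rfl
    exact hz ⟨1, by norm_num, Complex.ofReal_one⟩
  refine ⟨⟨M, fun z hz => hM z (hne z hz)⟩, fun z => (phi1 z).re, continuousOn_re_phi1,
    ⟨M, hM⟩, fun _ _ => rfl, ?_, ?_⟩
  · have h : Tendsto (fun x : ℝ => (x - 1)⁻¹) (𝓝[>] 1) atTop := by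
      refine tendsto_inv_nhdsGT_zero.comp (tendsto_nhdsWithin_iff.mpr ⟨?_, ?_⟩)
      · exact (Continuous.tendsto' (by fun_prop) _ _ (by simp)).mono_left nhdsWithin_le_nhds
      · filter_upwards [self_mem_nhdsWithin] with x hx
        exact sub_pos.mpr (mem_Ioi.mp hx)
    have h' := (tendsto_re_phi1_one_add (Or.inl rfl)).comp h
    rw [one_mul] at h'
    refine h'.congr fun x => ?_
    simp
  · have h : Tendsto (fun x : ℝ => (1 - x)⁻¹) (𝓝[<] 1) atTop := by
      refine tendsto_inv_nhdsGT_zero.comp (tendsto_nhdsWithin_iff.mpr ⟨?_, ?_⟩)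
      · exact (Continuous.tendsto' (by fun_prop) _ _ (by simp)).mono_left nhdsWithin_le_nhds
      · filter_upwards [self_mem_nhdsWithin] with x hx
        exact sub_pos.mpr (mem_Iio.mp hx)
    have h' := (tendsto_re_phi1_one_add (Or.inr rfl)).comp h
    rw [neg_one_mul, sub_neg_eq_add] at h'
    refine h'.congr fun x => ?_
    simp
end
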